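/- arXiv:1004.5183 — 3 statements merged into one kernel-verified Lean document; each statement's English description precedes it below -/
import Mathlib

section
/- For every n ≥ 2 and every cycle C of length k ≥ 3, the cycle C is n-monophilic; i.e., for every assignment L of n-element color lists to the vertices of C, the number of proper colorings of C from L is at least the number of proper colorings of C with all lists equal to {1,...,n}. -/
open SimpleGraph

open Classical in
/-- Number of proper colorings of `G` from list assignment `L`: functions `γ` with
`γ v ∈ L v` for all `v` and `γ v ≠ γ w` for adjacent `v, w`. -/
noncomputable def colCount {V : Type*} [Fintype V] (G : SimpleGraph V) (L : V → Finset ℕ) : ℕ :=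
  ((Fintype.piFinset L).filter fun γ => ∀ v w, G.Adj v w → γ v ≠ γ w).card

/-- `G` is `n`-monophilic: the constant assignment `{1,…,n}` minimizes the number of
list colorings among all `n`-list assignments. -/
def Monophilic {V : Type*} [Fintype V] (G : SimpleGraph V) (n : ℕ) : Prop :=
  ∀ L : V → Finset ℕ, (∀ v, (L v).card = n) →
    colCount G (fun _ => Finset.Icc 1 n) ≤ colCount G L

/-- The number of sequences `x₀, …, xᵢ` with `x₀ = c`, `xᵢ = a`, `xⱼ ∈ L j` for all `j`, and
consecutive terms distinct. -/
def walkCount (L : ℕ → Finset ℕ) (c : ℕ) : ℕ → ℕ → ℕ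
  | 0, a => if a = c ∧ c ∈ L 0 then 1 else 0
  | i + 1, a => if a ∈ L (i + 1) then ∑ b ∈ (L i).erase a, walkCount L c i b else 0

/-- The number of sequences `x₀, …, xᵢ` with `x₀ = c`, `xⱼ ∈ L j` for all `j`, and consecutive
terms distinct. -/
def walkTotal (L : ℕ → Finset ℕ) (c i : ℕ) : ℕ := ∑ b ∈ L i, walkCount L c i b

/-- The number of sequences counted by `walkTotal L c i` whose last term is not `c`. -/
def closedCount (L : ℕ → Finset ℕ) (c i : ℕ) : ℕ := ∑ b ∈ (L i).erase c, walkCount L c i b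

section Walks

variable {L : ℕ → Finset ℕ} {c i a : ℕ}

lemma walkCount_of_notMem (h : a ∉ L i) : walkCount L c i a = 0 := by
  cases i with
  | zero =>
    rw [walkCount, if_neg]
    rintro ⟨rfl, h'⟩
    exact h h'
  | succ i => rw [walkCount, if_neg h]

lemma sum_erase_add_walkCount (L : ℕ → Finset ℕ) (c i a : ℕ) :
    ∑ b ∈ (L i).erase a, walkCount L c i b + walkCount L c i a = walkTotal L c i := by
  by_cases h : a ∈ L i
  · exact Finset.sum_erase_add _ _ h
  · rw [Finset.erase_eq_of_notMem h, walkCount_of_notMem h, add_zero, walkTotal]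

lemma walkCount_succ_add (h : a ∈ L (i + 1)) :
    walkCount L c (i + 1) a + walkCount L c i a = walkTotal L c i := by
  rw [walkCount, if_pos h, sum_erase_add_walkCount]

lemma closedCount_add (L : ℕ → Finset ℕ) (c i : ℕ) :
    closedCount L c i + walkCount L c i c = walkTotal L c i :=
  sum_erase_add_walkCount L c i c

lemma walkTotal_succ_add (L : ℕ → Finset ℕ) (c i : ℕ) :
    walkTotal L c (i + 1) + ∑ a ∈ L (i + 1), walkCount L c i a =
      (L (i + 1)).card * walkTotal L c i := by
  rw [walkTotal, ← Finset.sum_add_distrib, Finset.sum_congr rfl fun a ha => walkCount_succ_add ha,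
    Finset.sum_const, smul_eq_mul]

lemma sum_walkCount_le (s : Finset ℕ) : ∑ a ∈ s, walkCount L c i a ≤ walkTotal L c i := by
  have h : ∑ a ∈ s, walkCount L c i a = ∑ a ∈ s ∩ L i, walkCount L c i a := by
    symm
    refine Finset.sum_subset Finset.inter_subset_left fun a ha ha' => walkCount_of_notMem ?_
    intro h
    exact ha' (Finset.mem_inter.2 ⟨ha, h⟩)
  rw [h]
  exact Finset.sum_le_sum_of_subset Finset.inter_subset_right

lemma sum_walkCount_add_le {s : Finset ℕ} (h : a ∉ s) :
    ∑ b ∈ s, walkCount L c i b + walkCount L c i a ≤ walkTotal L c i := by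
  have := sum_walkCount_le (L := L) (c := c) (i := i) (insert a s)
  rwa [Finset.sum_insert h, add_comm] at this

lemma mem_of_walkCount_pos (h : 0 < walkCount L c i a) : a ∈ L i := by
  by_contra h'
  rw [walkCount_of_notMem h'] at h
  exact h.false

lemma walkCount_succ_pos {b : ℕ} (hb : 0 < walkCount L c i b) (hba : b ≠ a)
    (ha : a ∈ L (i + 1)) : 0 < walkCount L c (i + 1) a := by
  rw [walkCount, if_pos ha]
  exact hb.trans_le <| Finset.single_le_sum (f := fun b => walkCount L c i b)
    (fun _ _ => Nat.zero_le _) (Finset.mem_erase.2 ⟨hba, mem_of_walkCount_pos hb⟩)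

lemma walkCount_one_pos (hc : c ∈ L 0) (ha : a ∈ L 1) (hac : c ≠ a) : 0 < walkCount L c 1 a :=
  walkCount_succ_pos (b := c) (by simp [walkCount, hc]) hac ha

lemma walkTotal_zero (hc : c ∈ L 0) : walkTotal L c 0 = 1 := by
  simp [walkTotal, walkCount, hc]

variable {q : ℕ} (hL : ∀ i, (L i).card = q + 1)
include hL

lemma mul_walkTotal_add_le (h : a ∉ L (i + 1)) :
    q * walkTotal L c i + walkCount L c i a ≤ walkTotal L c (i + 1) := by
  have h1 := walkTotal_succ_add L c i
  have h2 := sum_walkCount_add_le (L := L) (c := c) (i := i) h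
  rw [hL] at h1
  linarith

lemma mul_walkTotal_le : q * walkTotal L c i ≤ walkTotal L c (i + 1) := by
  have h1 := walkTotal_succ_add L c i
  have h2 := sum_walkCount_le (L := L) (c := c) (i := i) (L (i + 1))
  rw [hL] at h1
  linarith

lemma pow_le_walkTotal (hc : c ∈ L 0) (i : ℕ) : q ^ i ≤ walkTotal L c i := by
  induction i with
  | zero => rw [walkTotal_zero hc, pow_zero]
  | succ i ih =>
    rw [pow_succ']
    exact (Nat.mul_le_mul_left q ih).trans (mul_walkTotal_le hL)

lemma walkCount_pos (hq : 2 ≤ q) (hc : c ∈ L 0) (i : ℕ) (ha : a ∈ L (i + 2)) :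
    0 < walkCount L c (i + 2) a := by
  induction i generalizing a with
  | zero =>
    obtain ⟨b, hb⟩ : (((L 1).erase c).erase a).Nonempty := by
      rw [← Finset.card_pos]
      have h1 := Finset.pred_card_le_card_erase (s := L 1) (a := c)
      have h2 := Finset.pred_card_le_card_erase (s := (L 1).erase c) (a := a)
      have := hL 1
      omega
    simp only [Finset.mem_erase] at hb
    exact walkCount_succ_pos (walkCount_one_pos hc hb.2.2 (Ne.symm hb.2.1)) hb.1 ha
  | succ i ih =>
    obtain ⟨b, hb⟩ : ((L (i + 2)).erase a).Nonempty := by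
      rw [← Finset.card_pos]
      have h1 := Finset.pred_card_le_card_erase (s := L (i + 2)) (a := a)
      have := hL (i + 2)
      omega
    rw [Finset.mem_erase] at hb
    exact walkCount_succ_pos (ih hb.2) hb.1 ha

lemma pow_le_closedCount (hc : c ∈ L 0) (h : c ∉ L i) : q ^ i ≤ closedCount L c i := by
  have := closedCount_add L c i
  rw [walkCount_of_notMem h, add_zero] at this
  rw [this]
  exact pow_le_walkTotal hL hc i

lemma mul_walkTotal_add_le_closedCount (h : c ∈ L (i + 1)) :
    q * walkTotal L c i + walkCount L c i c ≤ closedCount L c (i + 1) + walkTotal L c i := by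
  have h1 := closedCount_add L c (i + 1)
  have h2 := walkCount_succ_add (c := c) h
  have h3 := mul_walkTotal_le (c := c) (i := i) hL
  omega

lemma sub_one_mul_pow_le_closedCount (hq : 1 ≤ q) (hc : c ∈ L 0) (i : ℕ) :
    (q - 1) * q ^ i ≤ closedCount L c (i + 1) := by
  obtain ⟨r, rfl⟩ := Nat.exists_eq_add_of_le' hq
  have h0 := pow_le_walkTotal hL hc i
  by_cases h : c ∈ L (i + 1)
  · have := mul_walkTotal_add_le_closedCount hL h
    rw [Nat.add_sub_cancel]
    have := Nat.mul_le_mul_left r h0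
    linarith
  · refine le_trans ?_ (pow_le_closedCount hL hc h)
    rw [pow_succ']
    exact Nat.mul_le_mul_right _ (Nat.sub_le _ _)

lemma sub_one_mul_pow_lt_closedCount (hq : 2 ≤ q) (hc : c ∈ L 0) (i : ℕ) :
    (q - 1) * q ^ (i + 2) < closedCount L c (i + 3) := by
  obtain ⟨r, rfl⟩ := Nat.exists_eq_add_of_le' hq
  have h0 := pow_le_walkTotal hL hc (i + 2)
  have h0' := Nat.mul_le_mul_left (r + 1) h0
  rw [show r + 2 - 1 = r + 1 by omega]
  by_cases h : c ∈ L (i + 3)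
  · by_cases h' : c ∈ L (i + 2)
    · have := mul_walkTotal_add_le_closedCount hL h
      have := walkCount_pos hL hq hc i h'
      linarith
    · obtain ⟨d, hd, hd'⟩ : ∃ d ∈ L (i + 2), d ∉ L (i + 3) := by
        by_contra! hs
        exact h' (Finset.eq_of_subset_of_card_le hs (by rw [hL, hL]) ▸ h)
      have := walkCount_pos hL hq hc i hd
      have := mul_walkTotal_add_le (c := c) hL hd'
      have h1 := closedCount_add L c (i + 3)
      have h2 := walkCount_succ_add (c := c) h
      linarith
  · refine lt_of_lt_of_le ?_ (pow_le_closedCount hL hc h)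
    rw [pow_succ' _ (i + 2)]
    exact Nat.mul_lt_mul_of_pos_right (Nat.lt_succ_self _) (by positivity)

lemma pow_le_sum_closedCount (hq : 1 ≤ q) {j : ℕ} (hne : L 0 ≠ L (j + 1)) :
    q ^ (j + 2) ≤ ∑ c ∈ L 0, closedCount L c (j + 1) := by
  obtain ⟨c, hc, hc'⟩ : ∃ c ∈ L 0, c ∉ L (j + 1) := by
    by_contra! hs
    exact hne (Finset.eq_of_subset_of_card_le hs (by rw [hL, hL]))
  rw [← Finset.sum_erase_add _ _ hc]
  have h1 := Finset.card_nsmul_le_sum ((L 0).erase c) (fun c => closedCount L c (j + 1)) _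
    fun d hd => sub_one_mul_pow_le_closedCount hL hq (Finset.mem_of_mem_erase hd) j
  have h2 := pow_le_closedCount hL hc hc'
  rw [Finset.card_erase_of_mem hc, hL, smul_eq_mul, Nat.add_sub_cancel] at h1
  obtain ⟨r, rfl⟩ := Nat.exists_eq_add_of_le' hq
  rw [Nat.add_sub_cancel] at h1
  calc _ = (r + 1) * (r * (r + 1) ^ j) + (r + 1) ^ (j + 1) := by ring
    _ ≤ _ := add_le_add h1 h2

lemma pow_add_le_sum_closedCount (hq : 2 ≤ q) {j : ℕ} (hne : L 0 ≠ L (j + 3)) :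
    q ^ (j + 4) + q ≤ ∑ c ∈ L 0, closedCount L c (j + 3) := by
  obtain ⟨c, hc, hc'⟩ : ∃ c ∈ L 0, c ∉ L (j + 3) := by
    by_contra! hs
    exact hne (Finset.eq_of_subset_of_card_le hs (by rw [hL, hL]))
  rw [← Finset.sum_erase_add _ _ hc]
  have h1 := Finset.card_nsmul_le_sum ((L 0).erase c) (fun c => closedCount L c (j + 3))
    ((q - 1) * q ^ (j + 2) + 1)
    fun d hd => sub_one_mul_pow_lt_closedCount hL hq (Finset.mem_of_mem_erase hd) j
  have h2 := pow_le_closedCount hL hc hc'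
  rw [Finset.card_erase_of_mem hc, hL, smul_eq_mul, Nat.add_sub_cancel] at h1
  obtain ⟨r, rfl⟩ := Nat.exists_eq_add_of_le' hq
  rw [show r + 2 - 1 = r + 1 by omega] at h1
  calc _ = (r + 2) * ((r + 1) * (r + 2) ^ (j + 2) + 1) + (r + 2) ^ (j + 3) := by ring
    _ ≤ _ := add_le_add h1 h2

end Walks

section TwoElementLists

variable {L : ℕ → Finset ℕ}

lemma two_lists_trichotomy (hL : ∀ i, (L i).card = 2) {c d : ℕ}
    (h0 : L 0 = {c, d}) (i : ℕ) :
    2 ≤ walkTotal L c i ∨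
    (∃ p r, p ≠ r ∧ 0 < walkCount L d i p ∧ 0 < walkCount L d i r) ∨
    (∃ p r, L i = {p, r} ∧ 0 < walkCount L c i p ∧ 0 < walkCount L d i r ∧
      ((Even i ∧ p = c ∧ r = d) ∨ (Odd i ∧ p = d ∧ r = c))) := by
  induction i with
  | zero =>
    refine Or.inr (Or.inr ⟨c, d, h0, ?_, ?_, Or.inl ⟨Even.zero, rfl, rfl⟩⟩) <;>
      simp [walkCount, h0]
  | succ i ih =>
    obtain ⟨x, y, hxy, hs⟩ := Finset.card_eq_two.1 (hL (i + 1))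
    have hx : x ∈ L (i + 1) := by simp [hs]
    have hy : y ∈ L (i + 1) := by simp [hs]
    rcases ih with h | ⟨p, r, hpr, hp, hr⟩ | ⟨p, r, hi, hp, hr, hpar⟩
    · left
      have := mul_walkTotal_le (c := c) (i := i) hL
      omega
    · have key : ∀ a ∈ L (i + 1), 0 < walkCount L d (i + 1) a := by
        intro a ha
        by_cases hpa : p = a
        · exact walkCount_succ_pos hr (fun h => hpr (hpa.trans h.symm)) ha
        · exact walkCount_succ_pos hp hpa ha
      exact Or.inr (Or.inl ⟨x, y, hxy, key x hx, key y hy⟩)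
    · by_cases hr' : r ∈ L (i + 1)
      · by_cases hp' : p ∈ L (i + 1)
        · have hpr : p ≠ r := by
            rintro rfl
            have := hL i
            simp [hi] at this
          refine Or.inr (Or.inr ⟨r, p, ?_, walkCount_succ_pos hp hpr hr',
            walkCount_succ_pos hr hpr.symm hp', ?_⟩)
          · symm
            refine Finset.eq_of_subset_of_card_le ?_ ?_
            · intro z hz
              simp only [Finset.mem_insert, Finset.mem_singleton] at hz
              rcases hz with rfl | rfl <;> assumption
            · rw [hL, Finset.card_pair hpr.symm]
          · rcases hpar with ⟨he, h1, h2⟩ | ⟨ho, h1, h2⟩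
            · exact Or.inr ⟨he.add_one, h2, h1⟩
            · exact Or.inl ⟨ho.add_one, h2, h1⟩
        · left
          have h1 := walkCount_succ_pos hp (fun h => hp' (h ▸ hx)) hx
          have h2 := walkCount_succ_pos hp (fun h => hp' (h ▸ hy)) hy
          rw [walkTotal, hs, Finset.sum_pair hxy]
          omega
      · exact Or.inr (Or.inl ⟨x, y, hxy, walkCount_succ_pos hr (fun h => hr' (h ▸ hx)) hx,
          walkCount_succ_pos hr (fun h => hr' (h ▸ hy)) hy⟩)

lemma two_le_sum_closedCount (hL : ∀ i, (L i).card = 2) {j : ℕ} (hj : Odd j)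
    (hne : L 0 ≠ L j) : 2 ≤ ∑ c ∈ L 0, closedCount L c j := by
  obtain ⟨c, hc, hc'⟩ : ∃ c ∈ L 0, c ∉ L j := by
    by_contra! hs
    exact hne (Finset.eq_of_subset_of_card_le hs (by rw [hL, hL]))
  obtain ⟨d, hd⟩ : ∃ d, (L 0).erase c = {d} := by
    rw [← Finset.card_eq_one, Finset.card_erase_of_mem hc, hL]
  have hdm : d ∈ (L 0).erase c := by simp [hd]
  have hcd : c ≠ d := (Finset.ne_of_mem_erase hdm).symm
  have h0 : L 0 = {c, d} := by rw [← hd, Finset.insert_erase hc]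
  have hc1 := closedCount_add L c j
  rw [walkCount_of_notMem hc', add_zero] at hc1
  have hc2 : 1 ≤ walkTotal L c j := by simpa using pow_le_walkTotal (q := 1) hL hc j
  rw [h0, Finset.sum_pair hcd, hc1]
  rcases two_lists_trichotomy hL h0 j with h | ⟨p, r, hpr, hp, hr⟩ | ⟨p, r, hi, hp, hr, hpar⟩
  · omega
  · have key : ∀ b, b ≠ d → 0 < walkCount L d j b → 1 ≤ closedCount L d j := fun b hbd hb =>
      hb.trans_le <| Finset.single_le_sum (f := fun b => walkCount L d j b)
        (fun _ _ => Nat.zero_le _) (Finset.mem_erase.2 ⟨hbd, mem_of_walkCount_pos hb⟩)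
    have : 1 ≤ closedCount L d j := by
      by_cases hpd : p = d
      · exact key r (fun h => hpr (hpd.trans h.symm)) hr
      · exact key p hpd hp
    omega
  · rcases hpar with ⟨he, -⟩ | ⟨-, -, rfl⟩
    · exact absurd hj (Nat.not_odd_iff_even.2 he)
    · exact absurd (mem_of_walkCount_pos hr) hc'

end TwoElementLists

section ConstantLists

variable {s : Finset ℕ} {q : ℕ} {c : ℕ}

lemma walkTotal_const (hs : s.card = q + 1) (hc : c ∈ s) (i : ℕ) :
    walkTotal (fun _ => s) c i = q ^ i := by
  induction i with
  | zero => exact walkTotal_zero (L := fun _ => s) hc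
  | succ i ih =>
    have h1 := walkTotal_succ_add (fun _ => s) c i
    have h2 : ∑ a ∈ s, walkCount (fun _ => s) c i a = walkTotal (fun _ => s) c i := rfl
    rw [h2, ih, hs] at h1
    rw [pow_succ']
    linarith

lemma walkCount_const (hs : s.card = q + 1) (hc : c ∈ s) (i : ℕ) :
    ((q : ℤ) + 1) * walkCount (fun _ => s) c i c = q ^ i + (-1) ^ i * q := by
  induction i with
  | zero =>
    simp [walkCount, hc]
    ring
  | succ i ih =>
    have := walkCount_succ_add (L := fun _ => s) (c := c) (i := i) hc
    rw [walkTotal_const hs hc] at this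
    zify at this
    rw [eq_sub_of_add_eq this, mul_sub, ih]
    ring

lemma sum_closedCount_const (hs : s.card = q + 1) (i : ℕ) :
    ((∑ c ∈ s, closedCount (fun _ => s) c i : ℕ) : ℤ) = q ^ (i + 1) + (-1) ^ (i + 1) * q := by
  have hcl : ∀ c ∈ s, ((q : ℤ) + 1) * closedCount (fun _ => s) c i =
      q ^ (i + 1) + (-1) ^ (i + 1) * q := by
    intro c hc
    have h1 := closedCount_add (fun _ => s) c i
    rw [walkTotal_const hs hc] at h1
    zify at h1
    rw [eq_sub_of_add_eq h1, mul_sub, walkCount_const hs hc]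
    ring
  have hq : (q : ℤ) + 1 ≠ 0 := by positivity
  apply mul_left_cancel₀ hq
  push_cast
  rw [Finset.mul_sum, Finset.sum_congr rfl hcl, Finset.sum_const, hs]
  simp

end ConstantLists

lemma sum_closedCount_const_le {L : ℕ → Finset ℕ} {s : Finset ℕ} {q m : ℕ}
    (hL : ∀ i, (L i).card = q + 1) (hs : s.card = q + 1) (hq : 1 ≤ q) (hm : 2 ≤ m)
    (hne : L 0 ≠ L m) :
    ∑ c ∈ s, closedCount (fun _ => s) c m ≤ ∑ c ∈ L 0, closedCount L c m := by
  have h := sum_closedCount_const hs m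
  rcases Nat.even_or_odd m with he | ho
  · obtain ⟨j, rfl⟩ := Nat.exists_eq_add_of_le' (show 1 ≤ m by omega)
    have := pow_le_sum_closedCount hL hq hne
    rw [he.add_one.neg_one_pow] at h
    zify at this ⊢
    push_cast at h
    linarith
  · obtain ⟨j, rfl⟩ : ∃ j, m = j + 3 := by
      obtain ⟨t, rfl⟩ := ho
      exact ⟨2 * t + 1 - 3, by omega⟩
    rw [ho.add_one.neg_one_pow, one_mul] at h
    rcases hq.eq_or_lt with rfl | hq
    · have := two_le_sum_closedCount hL ho hne
      simp only [Nat.cast_one, one_pow] at h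
      omega
    · have := pow_add_le_sum_closedCount hL hq hne
      zify at this ⊢
      push_cast at h
      linarith

section Cycles

open Classical in
lemma card_walks (L : ℕ → Finset ℕ) (c m a : ℕ) :
    ((Fintype.piFinset fun i : Fin (m + 1) => L i).filter fun γ =>
      (∀ i : Fin m, γ i.castSucc ≠ γ i.succ) ∧ γ 0 = c ∧ γ (Fin.last m) = a).card =
      walkCount L c m a := by
  induction m generalizing a with
  | zero =>
    rw [walkCount]
    split_ifs with h
    · obtain ⟨rfl, h⟩ := h
      rw [Finset.card_eq_one]
      refine ⟨fun _ => a, ?_⟩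
      ext γ
      simp only [Finset.mem_filter, Fintype.mem_piFinset, Finset.mem_singleton, funext_iff]
      constructor
      · rintro ⟨-, -, h1, -⟩ x
        rwa [Fin.fin_one_eq_zero x]
      · exact fun h' => ⟨fun x => by rw [h' x, Fin.val_eq_zero]; exact h, fun x => x.elim0,
          h' _, h' _⟩
    · rw [Finset.card_eq_zero, Finset.filter_eq_empty_iff]
      rintro γ hγ ⟨-, rfl, h2⟩
      exact h ⟨h2.symm, Fintype.mem_piFinset.1 hγ 0⟩
  | succ m ih =>
    rw [walkCount]
    split_ifs with h
    · rw [Finset.card_eq_sum_card_fiberwise (f := fun γ => γ (Fin.last m).castSucc)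
        (t := (L m).erase a)]
      · refine Finset.sum_congr rfl fun b hb => ?_
        rw [← ih b]
        refine Finset.card_nbij' (fun γ => Fin.init γ)
          (fun γ => Fin.snoc (α := fun _ => ℕ) γ a) ?_ ?_ ?_ ?_
        · intro γ hγ
          simp only [Finset.coe_filter, Finset.mem_filter, Fintype.mem_piFinset,
            Set.mem_ofPred_eq] at hγ ⊢
          obtain ⟨⟨h1, h2, h3, h4⟩, h5⟩ := hγ
          exact ⟨fun i => h1 i.castSucc, fun i => h2 i.castSucc, h3, h5⟩
        · intro γ hγ
          simp only [Finset.coe_filter, Finset.mem_filter, Fintype.mem_piFinset,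
            Set.mem_ofPred_eq] at hγ ⊢
          obtain ⟨h1, h2, h3, h4⟩ := hγ
          refine ⟨⟨?_, ?_, ?_, ?_⟩, ?_⟩
          · intro i
            refine Fin.lastCases ?_ (fun i => ?_) i
            · simpa using h
            · simpa using h1 i
          · intro i
            refine Fin.lastCases ?_ (fun i => ?_) i
            · rw [Fin.succ_last, Fin.snoc_last, Fin.snoc_castSucc, h4]
              exact Finset.ne_of_mem_erase hb
            · rw [← Fin.castSucc_succ, Fin.snoc_castSucc, Fin.snoc_castSucc]
              exact h2 i
          · rw [← Fin.castSucc_zero, Fin.snoc_castSucc, h3]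
          · rw [Fin.snoc_last]
          · rw [Fin.snoc_castSucc, h4]
        · intro γ hγ
          simp only [Finset.coe_filter, Finset.mem_filter, Set.mem_ofPred_eq] at hγ
          rw [← hγ.1.2.2.2]
          exact Fin.snoc_init_self γ
        · intro γ _
          exact Fin.init_snoc _ _
      · intro γ hγ
        simp only [Finset.coe_filter, Fintype.mem_piFinset, Set.mem_ofPred_eq] at hγ
        obtain ⟨h1, h2, -, h4⟩ := hγ
        rw [Finset.mem_coe, Finset.mem_erase]
        refine ⟨?_, h1 (Fin.last m).castSucc⟩
        rw [← h4]
        exact h2 (Fin.last m)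
    · rw [Finset.card_eq_zero, Finset.filter_eq_empty_iff]
      rintro γ hγ ⟨-, -, rfl⟩
      exact h (Fintype.mem_piFinset.1 hγ (Fin.last (m + 1)))

lemma cycleGraph_proper_iff {m : ℕ} (γ : Fin (m + 2) → ℕ) :
    (∀ v w, (cycleGraph (m + 2)).Adj v w → γ v ≠ γ w) ↔
      (∀ i : Fin (m + 1), γ i.castSucc ≠ γ i.succ) ∧ γ (Fin.last (m + 1)) ≠ γ 0 := by
  have h1 : (∀ v w, (cycleGraph (m + 2)).Adj v w → γ v ≠ γ w) ↔ ∀ v, γ v ≠ γ (v + 1) := by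
    constructor
    · exact fun h v => h v (v + 1) (by simp [cycleGraph_adj])
    · intro h v w hvw
      rw [cycleGraph_adj, sub_eq_iff_eq_add', sub_eq_iff_eq_add'] at hvw
      rcases hvw with rfl | rfl
      · exact (h w).symm
      · exact h v
  rw [h1, Fin.forall_fin_succ']
  simp [Fin.coeSucc_eq_succ, Fin.last_add_one]

lemma colCount_cycleGraph (L : ℕ → Finset ℕ) (m : ℕ) :
    colCount (cycleGraph (m + 2)) (fun i => L i) = ∑ c ∈ L 0, closedCount L c (m + 1) := by
  classical
  rw [colCount, Finset.card_eq_sum_card_fiberwise (f := fun γ => γ 0) (t := L 0)]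
  · refine Finset.sum_congr rfl fun c hc => ?_
    rw [closedCount, Finset.card_eq_sum_card_fiberwise (f := fun γ => γ (Fin.last (m + 1)))
      (t := (L (m + 1)).erase c)]
    · refine Finset.sum_congr rfl fun b hb => ?_
      rw [← card_walks, Finset.filter_filter, Finset.filter_filter]
      congr 1
      ext γ
      simp only [Finset.mem_filter, Fintype.mem_piFinset, cycleGraph_proper_iff]
      constructor
      · rintro ⟨h, ⟨h1, -⟩, h3, h4⟩
        exact ⟨h, h1, h3, h4⟩
      · rintro ⟨h, h1, h3, h4⟩
        exact ⟨h, ⟨h1, by rw [h3, h4]; exact Finset.ne_of_mem_erase hb⟩, h3, h4⟩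
    · intro γ hγ
      simp only [Finset.coe_filter, Finset.mem_filter, Fintype.mem_piFinset, Set.mem_ofPred_eq,
        cycleGraph_proper_iff] at hγ
      obtain ⟨⟨h1, -, h2⟩, rfl⟩ := hγ
      exact Finset.mem_coe.2 (Finset.mem_erase.2 ⟨h2, h1 (Fin.last (m + 1))⟩)
  · intro γ hγ
    simp only [Finset.coe_filter, Fintype.mem_piFinset, Set.mem_ofPred_eq] at hγ
    exact hγ.1 0

lemma colCount_comp_iso {V W : Type*} [Fintype V] [Fintype W] {G : SimpleGraph V}
    {H : SimpleGraph W} (e : G ≃g H) (L : W → Finset ℕ) :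
    colCount G (fun v => L (e v)) = colCount H L := by
  classical
  refine Finset.card_nbij' (fun γ w => γ (e.symm w)) (fun γ v => γ (e v)) ?_ ?_ ?_ ?_
  · intro γ hγ
    simp only [Finset.coe_filter, Fintype.mem_piFinset, Set.mem_ofPred_eq] at hγ ⊢
    exact ⟨fun w => by simpa using hγ.1 (e.symm w),
      fun v w h => hγ.2 _ _ (e.symm.map_adj_iff.2 h)⟩
  · intro γ hγ
    simp only [Finset.coe_filter, Fintype.mem_piFinset, Set.mem_ofPred_eq] at hγ ⊢
    exact ⟨fun w => hγ.1 (e w), fun v w h => hγ.2 _ _ (e.map_adj_iff.2 h)⟩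
  · intro γ _
    simp
  · intro γ _
    simp

/-- Rotation of a cycle. -/
def cycleGraphRotate {m : ℕ} (r : Fin (m + 2)) : cycleGraph (m + 2) ≃g cycleGraph (m + 2) where
  toEquiv := Equiv.addRight r
  map_rel_iff' := by simp [cycleGraph_adj]

end Cycles

theorem stmt8 (n k : ℕ) (hn : 2 ≤ n) (hk : 3 ≤ k) :
    Monophilic (cycleGraph k) n := by
  intro L hL
  obtain ⟨m, rfl⟩ := Nat.exists_eq_add_of_le' hk
  obtain ⟨q, rfl⟩ := Nat.exists_eq_add_of_le' (show 1 ≤ n by omega)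
  have hI : (Finset.Icc 1 (q + 1)).card = q + 1 := by simp
  rw [colCount_cycleGraph (fun _ => Finset.Icc 1 (q + 1)) (m + 1)]
  by_cases hne : ∃ i, L i ≠ L (i + 1)
  · obtain ⟨i, hi⟩ := hne
    rw [← colCount_comp_iso (cycleGraphRotate (i + 1)) L]
    set M : ℕ → Finset ℕ := fun j => L (Fin.ofNat (m + 3) j + (i + 1))
    have hM : (fun v => L (cycleGraphRotate (i + 1) v)) = fun v : Fin (m + 3) => M v := by
      funext v
      simp [M, cycleGraphRotate, add_assoc]
    rw [hM, colCount_cycleGraph M (m + 1)]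
    refine sum_closedCount_const_le (fun j => hL _) hI (by omega) (by omega) ?_
    have h0 : M 0 = L (i + 1) := by simp [M]
    have h1 : M (m + 2) = L i := by
      have : Fin.ofNat (m + 3) (m + 2) = Fin.last (m + 2) := by ext; simp
      simp only [M]
      rw [this, add_comm i, ← add_assoc, Fin.last_add_one, zero_add]
    rw [h0, h1]
    exact hi.symm
  · push Not at hne
    have hconst : ∀ i, L i = L 0 := fun i => by
      induction i using Fin.induction with
      | zero => rfl
      | succ i ih => rw [← ih, hne i.castSucc, Fin.coeSucc_eq_succ]
    rw [show L = fun _ => L 0 from funext hconst, colCount_cycleGraph (fun _ => L 0) (m + 1)]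
    apply le_of_eq
    zify
    have h1 := sum_closedCount_const hI (m + 2)
    have h2 := sum_closedCount_const (hL 0) (m + 2)
    push_cast at h1 h2
    rw [h1, h2]
end

section
/- A connected graph is 2-monophilic if and only if its core is a single vertex, a cycle, the complete bipartite graph K_{2,3}, or contains an odd cycle. -/
open SimpleGraph

open Classical in
/-- One step of core formation: delete a vertex whose degree in the induced
subgraph on `s` equals 1. -/
noncomputable def DelStep {V : Type*} [Fintype V] (G : SimpleGraph V) (s t : Finset V) : Prop :=
  ∃ v ∈ s, (s.filter fun w => G.Adj v w).card = 1 ∧ t = s.erase v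

open Classical in
/-- `s` is (the vertex set of) the core of `G`: it is obtained from the full vertex set by
repeatedly deleting vertices of degree 1, and no vertex of `s` has degree 1 in the
induced subgraph on `s`. -/
noncomputable def IsCore {V : Type*} [Fintype V] (G : SimpleGraph V) (s : Finset V) : Prop :=
  Relation.ReflTransGen (DelStep G) Finset.univ s ∧
    ∀ v ∈ s, (s.filter fun w => G.Adj v w).card ≠ 1

section

variable {V W : Type*} {G : SimpleGraph V} {H : SimpleGraph W}

/-- `φ` is a proper coloring, from the lists `L`, of the subgraph of `G` induced on `T`. -/
structure IsListColoringOn (G : SimpleGraph V) (L : V → Finset ℕ) (T : Set V) (φ : V → ℕ) :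
    Prop where
  mem : ∀ v ∈ T, φ v ∈ L v
  ne : ∀ v ∈ T, ∀ w ∈ T, G.Adj v w → φ v ≠ φ w

theorem IsListColoringOn.mono {L : V → Finset ℕ} {S T : Set V} {φ : V → ℕ}
    (h : IsListColoringOn G L T φ) (hST : S ⊆ T) : IsListColoringOn G L S φ :=
  ⟨fun v hv => h.mem v (hST hv), fun v hv w hw => h.ne v (hST hv) w (hST hw)⟩

/-- Some assignment of lists of size two admits at most one coloring of `G` on `T`. -/
def Rigid (G : SimpleGraph V) (T : Set V) : Prop :=
  ∃ L : V → Finset ℕ, (∀ v, (L v).card = 2) ∧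
    ∀ φ ψ, IsListColoringOn G L T φ → IsListColoringOn G L T ψ → Set.EqOn φ ψ T

/-- A proper coloring of `G` with the colors `1` and `2`. -/
abbrev IsTwoColoring (G : SimpleGraph V) (c : V → ℕ) : Prop :=
  IsListColoringOn G (fun _ => Finset.Icc 1 2) Set.univ c

theorem IsTwoColoring.bounds {c : V → ℕ} (hc : IsTwoColoring G c) (v : V) :
    1 ≤ c v ∧ c v ≤ 2 :=
  Finset.mem_Icc.1 (hc.mem v trivial)

theorem IsTwoColoring.adj_ne {c : V → ℕ} (hc : IsTwoColoring G c) {v w : V} (h : G.Adj v w) :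
    c v ≠ c w :=
  hc.ne v trivial w trivial h

theorem Rigid.of_forall_not {L : V → Finset ℕ} (hL : ∀ v, (L v).card = 2) {T : Set V}
    (h : ∀ φ, ¬ IsListColoringOn G L T φ) : Rigid G T :=
  ⟨L, hL, fun φ _ hφ _ => (h φ hφ).elim⟩

/-- Rigidity spreads to an adjacent vertex, whose list can be chosen to force its color. -/
theorem Rigid.insert_of_adj {T : Set V} (hT : Rigid G T) {v w : V} (hw : w ∈ T) (hv : v ∉ T)
    (hvw : G.Adj v w) : Rigid G (insert v T) := by
  classical
  obtain ⟨L, hL, huniq⟩ := hT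
  by_cases hex : ∃ φ, IsListColoringOn G L T φ
  · obtain ⟨φ₀, hφ₀⟩ := hex
    have key : ∀ φ, IsListColoringOn G (Function.update L v {φ₀ w, φ₀ w + 1}) (insert v T) φ →
        φ v = φ₀ w + 1 ∧ Set.EqOn φ φ₀ T := by
      intro φ hφ
      have h1 : IsListColoringOn G L T φ := by
        refine ⟨fun u hu => ?_, (hφ.mono (Set.subset_insert v T)).ne⟩
        have := hφ.mem u (Set.mem_insert_of_mem v hu)
        rwa [Function.update_of_ne (ne_of_mem_of_not_mem hu hv)] at this
      have h2 := huniq φ φ₀ h1 hφ₀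
      refine ⟨?_, h2⟩
      have h3 := hφ.mem v (Set.mem_insert v T)
      have h4 := hφ.ne v (Set.mem_insert v T) w (Set.mem_insert_of_mem v hw) hvw
      rw [h2 hw] at h4
      simpa [h4] using h3
    refine ⟨Function.update L v {φ₀ w, φ₀ w + 1}, fun u => ?_, fun φ ψ hφ hψ u hu => ?_⟩
    · rcases eq_or_ne u v with rfl | h
      · simp
      · simp [Function.update_of_ne h, hL]
    · obtain ⟨h1, h2⟩ := key φ hφ
      obtain ⟨h3, h4⟩ := key ψ hψ
      rcases hu with rfl | hu
      · rw [h1, h3]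
      · rw [h2 hu, h4 hu]
  · push Not at hex
    exact Rigid.of_forall_not hL fun φ hφ => hex φ (hφ.mono (Set.subset_insert v T))

theorem Rigid.univ [Fintype V] (hG : G.Connected) {T : Set V} (hT : Rigid G T)
    (hne : T.Nonempty) : Rigid G Set.univ := by
  classical
  induction hn : Tᶜ.ncard using Nat.strong_induction_on generalizing T with
  | _ n ih =>
    by_cases hall : T = Set.univ
    · exact hall ▸ hT
    obtain ⟨v, hv⟩ := (Set.ne_univ_iff_exists_notMem T).1 hall
    obtain ⟨u, hu⟩ := hne
    obtain ⟨p⟩ := hG.preconnected u v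
    obtain ⟨d, -, hd1, hd2⟩ := p.exists_boundary_dart T hu hv
    refine ih _ ?_ (hT.insert_of_adj hd1 hd2 d.adj.symm) (Set.insert_nonempty _ _) rfl
    rw [← hn]
    refine Set.ncard_lt_ncard ?_
    exact compl_lt_compl_iff_lt.2 (Set.ssubset_insert hd2)

theorem rigid_range_iff (f : H ↪g G) : Rigid G (Set.range f) ↔ Rigid H Set.univ := by
  constructor
  · rintro ⟨L, hL, huniq⟩
    refine ⟨L ∘ f, fun v => hL _, fun φ ψ hφ hψ v _ => ?_⟩
    have key : ∀ φ, IsListColoringOn H (L ∘ f) Set.univ φ →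
        IsListColoringOn G L (Set.range f) (Function.extend f φ 0) := by
      intro φ hφ
      constructor
      · rintro _ ⟨v, rfl⟩
        rw [f.injective.extend_apply]
        exact hφ.mem v trivial
      · rintro _ ⟨v, rfl⟩ _ ⟨w, rfl⟩ h
        rw [f.injective.extend_apply, f.injective.extend_apply]
        exact hφ.ne v trivial w trivial (f.map_adj_iff.1 h)
    have := huniq _ _ (key φ hφ) (key ψ hψ) ⟨v, rfl⟩
    rwa [f.injective.extend_apply, f.injective.extend_apply] at this
  · rintro ⟨L, hL, huniq⟩
    refine ⟨Function.extend f L fun _ => {1, 2}, fun v => ?_, ?_⟩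
    · by_cases h : ∃ w, f w = v
      · obtain ⟨w, rfl⟩ := h
        rw [f.injective.extend_apply, hL]
      · rw [Function.extend_apply' _ _ _ h]
        rfl
    · have key : ∀ φ, IsListColoringOn G (Function.extend f L fun _ => {1, 2}) (Set.range f) φ →
          IsListColoringOn H L Set.univ (φ ∘ f) := by
        intro φ hφ
        refine ⟨fun v _ => ?_, fun v _ w _ h => hφ.ne _ ⟨v, rfl⟩ _ ⟨w, rfl⟩ (f.map_adj_iff.2 h)⟩
        have := hφ.mem (f v) ⟨v, rfl⟩
        rwa [f.injective.extend_apply] at this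
      rintro φ ψ hφ hψ _ ⟨v, rfl⟩
      exact huniq _ _ (key φ hφ) (key ψ hψ) (Set.mem_univ v)

theorem rigid_univ_congr (e : H ≃g G) : Rigid G Set.univ ↔ Rigid H Set.univ := by
  have h := rigid_range_iff e.toEmbedding
  rwa [show Set.range e.toEmbedding = Set.univ from e.surjective.range_eq] at h

theorem rigid_induce_iff {S : Set V} : Rigid (G.induce S) Set.univ ↔ Rigid G S := by
  have h := rigid_range_iff (Embedding.induce (G := G) S)
  rw [show Set.range (Embedding.induce (G := G) S) = S from Subtype.range_coe] at h
  exact h.symm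

theorem induce_preconnected_iff_forall {S : Set V} :
    (G.induce S).Preconnected ↔ ∀ A : V → Prop,
      (∀ v ∈ S, ∀ w ∈ S, G.Adj v w → A v → A w) → ∀ v ∈ S, ∀ w ∈ S, A v → A w := by
  constructor
  · intro h A hA v hv w hw hAv
    obtain ⟨p⟩ := h ⟨v, hv⟩ ⟨w, hw⟩
    by_contra hAw
    obtain ⟨d, -, hd1, hd2⟩ := p.exists_boundary_dart {u | A u} hAv hAw
    exact hd2 (hA _ d.fst.2 _ d.snd.2 d.adj hd1)
  · rintro h ⟨v, hv⟩ ⟨w, hw⟩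
    obtain ⟨hw', hr⟩ := h (fun u => ∃ hu : u ∈ S, (G.induce S).Reachable ⟨v, hv⟩ ⟨u, hu⟩)
      (fun a ha b hb hab ⟨_, hr⟩ => ⟨hb, hr.trans (Adj.reachable (by simpa using hab))⟩)
      v hv w hw ⟨hv, Reachable.refl _⟩
    exact hr

/-- On a connected set there are at most two colorings with the colors `1` and `2`. -/
theorem eqOn_or_eqOn_of_preconnected {c φ : V → ℕ} {S : Set V}
    (hS : (G.induce S).Preconnected)
    (hc : IsListColoringOn G (fun _ => Finset.Icc 1 2) S c)
    (hφ : IsListColoringOn G (fun _ => Finset.Icc 1 2) S φ) :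
    (∀ v ∈ S, φ v = c v) ∨ ∀ v ∈ S, φ v = 3 - c v := by
  have key := induce_preconnected_iff_forall.1 hS (fun v => φ v = c v) fun v hv w hw h hv' => by
    have h1 := Finset.mem_Icc.1 (hc.mem v hv)
    have h2 := Finset.mem_Icc.1 (hc.mem w hw)
    have h3 := Finset.mem_Icc.1 (hφ.mem w hw)
    have h4 := hc.ne v hv w hw h
    have h5 := hφ.ne v hv w hw h
    omega
  by_cases h : ∃ v ∈ S, φ v = c v
  · obtain ⟨v, hv, hv'⟩ := h
    exact Or.inl fun w hw => key v hv w hw hv'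
  · push Not at h
    right
    intro v hv
    have h1 := Finset.mem_Icc.1 (hc.mem v hv)
    have h2 := Finset.mem_Icc.1 (hφ.mem v hv)
    have h3 := h v hv
    omega

/-- Two disjoint edges outside a connected set `S`, all of whose ends have neighbors in `S`,
can be used to rule out both colorings of `S` with the colors `1` and `2`. -/
theorem rigid_univ_of_two_edges {c : V → ℕ} (hc : IsTwoColoring G c) {S : Set V}
    (hS : (G.induce S).Preconnected) {t₁ t₂ r₁ r₂ a₁ a₂ b₁ b₂ : V}
    (ht₁ : t₁ ∉ S) (ht₂ : t₂ ∉ S) (hr₁ : r₁ ∉ S) (hr₂ : r₂ ∉ S)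
    (h₁₁ : t₁ ≠ r₁) (h₁₂ : t₁ ≠ r₂) (h₂₁ : t₂ ≠ r₁) (h₂₂ : t₂ ≠ r₂)
    (ht : G.Adj t₁ t₂) (hr : G.Adj r₁ r₂)
    (ha₁ : a₁ ∈ S) (ha₂ : a₂ ∈ S) (hb₁ : b₁ ∈ S) (hb₂ : b₂ ∈ S)
    (hta₁ : G.Adj t₁ a₁) (hta₂ : G.Adj t₂ a₂) (hrb₁ : G.Adj r₁ b₁) (hrb₂ : G.Adj r₂ b₂) :
    Rigid G Set.univ := by
  classical
  set L : V → Finset ℕ := fun v =>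
    if v = t₁ then {c a₁, 3} else if v = t₂ then {c a₂, 3} else
    if v = r₁ then {3 - c b₁, 3} else if v = r₂ then {3 - c b₂, 3} else Finset.Icc 1 2 with hLdef
  have hLS : ∀ v ∈ S, L v = Finset.Icc 1 2 := by
    intro v hv
    have e1 : v ≠ t₁ := fun h => ht₁ (h ▸ hv)
    have e2 : v ≠ t₂ := fun h => ht₂ (h ▸ hv)
    have e3 : v ≠ r₁ := fun h => hr₁ (h ▸ hv)
    have e4 : v ≠ r₂ := fun h => hr₂ (h ▸ hv)
    simp [hLdef, e1, e2, e3, e4]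
  have hLt₁ : L t₁ = {c a₁, 3} := by simp [hLdef]
  have hLt₂ : L t₂ = {c a₂, 3} := by simp [hLdef, ht.ne']
  have hLr₁ : L r₁ = {3 - c b₁, 3} := by simp [hLdef, h₁₁.symm, h₂₁.symm]
  have hLr₂ : L r₂ = {3 - c b₂, 3} := by simp [hLdef, h₁₂.symm, h₂₂.symm, hr.ne']
  refine Rigid.of_forall_not (L := L) (fun v => ?_) fun φ hφ => ?_
  · have := hc.bounds a₁
    have := hc.bounds a₂
    have := hc.bounds b₁
    have := hc.bounds b₂
    simp only [hLdef]
    split_ifs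
    iterate 4 exact Finset.card_pair (by omega)
    rfl
  · have m1 := hφ.mem t₁ trivial
    have m2 := hφ.mem t₂ trivial
    have m3 := hφ.mem r₁ trivial
    have m4 := hφ.mem r₂ trivial
    rw [hLt₁, Finset.mem_insert, Finset.mem_singleton] at m1
    rw [hLt₂, Finset.mem_insert, Finset.mem_singleton] at m2
    rw [hLr₁, Finset.mem_insert, Finset.mem_singleton] at m3
    rw [hLr₂, Finset.mem_insert, Finset.mem_singleton] at m4
    have n1 := hφ.ne _ trivial _ trivial hta₁
    have n2 := hφ.ne _ trivial _ trivial hta₂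
    have n3 := hφ.ne _ trivial _ trivial hrb₁
    have n4 := hφ.ne _ trivial _ trivial hrb₂
    have n5 := hφ.ne _ trivial _ trivial ht
    have n6 := hφ.ne _ trivial _ trivial hr
    rcases eqOn_or_eqOn_of_preconnected hS (hc.mono (Set.subset_univ S))
      ⟨fun v hv => hLS v hv ▸ hφ.mem v trivial, (hφ.mono (Set.subset_univ S)).ne⟩ with h | h
    · rw [h a₁ ha₁] at n1
      rw [h a₂ ha₂] at n2
      omega
    · rw [h b₁ hb₁] at n3
      rw [h b₂ hb₂] at n4
      omega

/-- A connected set `S` containing a path of length two from `u` to a neighbor `q` of `w`,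
together with a second path `u p w` and a path `b t t' w` leaving `S`, is rigid. -/
theorem rigid_univ_of_theta [Fintype V] (hG : G.Connected) {c : V → ℕ} (hc : IsTwoColoring G c)
    {S : Set V} (hS : (G.induce S).Preconnected) {u q b w p t t' : V}
    (hu : u ∈ S) (hq : q ∈ S) (hb : b ∈ S) (hw : w ∉ S) (hp : p ∉ S) (ht : t ∉ S) (ht' : t' ∉ S)
    (hpt : p ≠ t) (hpt' : p ≠ t') (hwt : w ≠ t)
    (huq : G.Adj u q) (hqw : G.Adj q w) (hpu : G.Adj p u) (hpw : G.Adj p w)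
    (htb : G.Adj t b) (htt' : G.Adj t t') (htw' : G.Adj t' w) :
    Rigid G Set.univ := by
  classical
  set L : V → Finset ℕ := fun v =>
    if v = w then {c u, 3} else if v = p then {3 - c u, 3} else
    if v = t then {c b, 4} else if v = t' then {c u, 4} else Finset.Icc 1 2 with hLdef
  have hLS : ∀ v ∈ S, L v = Finset.Icc 1 2 := by
    intro v hv
    have e1 : v ≠ w := fun h => hw (h ▸ hv)
    have e2 : v ≠ p := fun h => hp (h ▸ hv)
    have e3 : v ≠ t := fun h => ht (h ▸ hv)
    have e4 : v ≠ t' := fun h => ht' (h ▸ hv)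
    simp [hLdef, e1, e2, e3, e4]
  have hLw : L w = {c u, 3} := by simp [hLdef]
  have hLp : L p = {3 - c u, 3} := by simp [hLdef, hpw.ne]
  have hLt : L t = {c b, 4} := by simp [hLdef, hwt.symm, hpt.symm]
  have hLt' : L t' = {c u, 4} := by simp [hLdef, htw'.ne, hpt'.symm, htt'.ne']
  set T : Set V := insert w (insert p (insert t (insert t' S))) with hT
  have hwT : w ∈ T := by simp [hT]
  have hpT : p ∈ T := by simp [hT]
  have htT : t ∈ T := by simp [hT]
  have htT' : t' ∈ T := by simp [hT]
  have hST : S ⊆ T := fun v hv => by simp [hT, hv]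
  have key : ∀ φ, IsListColoringOn G L T φ →
      (∀ v ∈ S, φ v = c v) ∧ φ w = 3 ∧ φ p = 3 - c u ∧ φ t = 4 ∧ φ t' = c u := by
    intro φ hφ
    have m1 := hφ.mem w hwT
    have m2 := hφ.mem p hpT
    have m3 := hφ.mem t htT
    have m4 := hφ.mem t' htT'
    rw [hLw, Finset.mem_insert, Finset.mem_singleton] at m1
    rw [hLp, Finset.mem_insert, Finset.mem_singleton] at m2
    rw [hLt, Finset.mem_insert, Finset.mem_singleton] at m3
    rw [hLt', Finset.mem_insert, Finset.mem_singleton] at m4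
    have n1 := hφ.ne _ (hST hq) _ hwT hqw
    have n2 := hφ.ne _ hpT _ (hST hu) hpu
    have n3 := hφ.ne _ hpT _ hwT hpw
    have n4 := hφ.ne _ htT _ (hST hb) htb
    have n5 := hφ.ne _ htT _ htT' htt'
    have n6 := hφ.ne _ htT' _ hwT htw'
    have := hc.bounds u
    have := hc.bounds q
    have := hc.adj_ne huq
    rcases eqOn_or_eqOn_of_preconnected hS (hc.mono (Set.subset_univ S))
      ⟨fun v hv => hLS v hv ▸ hφ.mem v (hST hv), (hφ.mono hST).ne⟩ with h | h
    · refine ⟨h, ?_⟩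
      rw [h b hb] at n4
      omega
    · rw [h u hu] at n2
      rw [h q hq] at n1
      omega
  refine Rigid.univ hG (T := T) ⟨L, fun v => ?_, fun φ ψ hφ hψ v hv => ?_⟩ ⟨w, hwT⟩
  · have := hc.bounds u
    have := hc.bounds b
    simp only [hLdef]
    split_ifs
    iterate 4 exact Finset.card_pair (by omega)
    rfl
  · obtain ⟨k1, k2, k3, k4, k5⟩ := key φ hφ
    obtain ⟨l1, l2, l3, l4, l5⟩ := key ψ hψ
    rcases hv with rfl | rfl | rfl | rfl | hv
    · rw [k2, l2]
    · rw [k3, l3]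
    · rw [k4, l4]
    · rw [k5, l5]
    · rw [k1 v hv, l1 v hv]

/-- A complete bipartite graph `K_{2,4}` has lists of size two without any coloring. -/
theorem rigid_univ_of_four_common_neighbors {u w p₁ p₂ p₃ p₄ : V} (huw : u ≠ w)
    (h₁₂ : p₁ ≠ p₂) (h₁₃ : p₁ ≠ p₃) (h₁₄ : p₁ ≠ p₄) (h₂₃ : p₂ ≠ p₃) (h₂₄ : p₂ ≠ p₄)
    (h₃₄ : p₃ ≠ p₄) (hu₁ : G.Adj u p₁) (hu₂ : G.Adj u p₂) (hu₃ : G.Adj u p₃) (hu₄ : G.Adj u p₄)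
    (hw₁ : G.Adj w p₁) (hw₂ : G.Adj w p₂) (hw₃ : G.Adj w p₃) (hw₄ : G.Adj w p₄) :
    Rigid G Set.univ := by
  classical
  set L : V → Finset ℕ := fun v =>
    if v = u then {1, 2} else if v = w then {3, 4} else
    if v = p₁ then {1, 3} else if v = p₂ then {1, 4} else if v = p₃ then {2, 3} else {2, 4}
    with hLdef
  refine Rigid.of_forall_not (L := L) (fun v => ?_) fun φ hφ => ?_
  · simp only [hLdef]
    split_ifs <;> rfl
  · have m1 := hφ.mem u trivial
    have m2 := hφ.mem w trivial
    have m3 := hφ.mem p₁ trivial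
    have m4 := hφ.mem p₂ trivial
    have m5 := hφ.mem p₃ trivial
    have m6 := hφ.mem p₄ trivial
    simp [hLdef] at m1
    simp [hLdef, huw.symm] at m2
    simp [hLdef, hu₁.ne', hw₁.ne'] at m3
    simp [hLdef, hu₂.ne', hw₂.ne', h₁₂.symm] at m4
    simp [hLdef, hu₃.ne', hw₃.ne', h₁₃.symm, h₂₃.symm] at m5
    simp [hLdef, hu₄.ne', hw₄.ne', h₁₄.symm, h₂₄.symm, h₃₄.symm] at m6
    have := hφ.ne _ trivial _ trivial hu₁
    have := hφ.ne _ trivial _ trivial hu₂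
    have := hφ.ne _ trivial _ trivial hu₃
    have := hφ.ne _ trivial _ trivial hu₄
    have := hφ.ne _ trivial _ trivial hw₁
    have := hφ.ne _ trivial _ trivial hw₂
    have := hφ.ne _ trivial _ trivial hw₃
    have := hφ.ne _ trivial _ trivial hw₄
    omega

/-- `x 0, …, x m` is a path in `G`. -/
structure IsPathSeq (G : SimpleGraph V) (x : ℕ → V) (m : ℕ) : Prop where
  inj : ∀ i ≤ m, ∀ j ≤ m, x i = x j → i = j
  adj : ∀ i < m, G.Adj (x i) (x (i + 1))

namespace IsPathSeq

variable {x : ℕ → V} {m : ℕ}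

theorem ne (hx : IsPathSeq G x m) {i j : ℕ} (hi : i ≤ m) (hj : j ≤ m) (hij : i ≠ j) :
    x i ≠ x j :=
  fun h => hij (hx.inj i hi j hj h)

theorem notMem_image (hx : IsPathSeq G x m) {I : Set ℕ} (hI : ∀ i ∈ I, i ≤ m) {k : ℕ}
    (hk : k ≤ m) (hkI : k ∉ I) : x k ∉ x '' I := by
  rintro ⟨i, hi, h⟩
  exact hkI (hx.inj i (hI i hi) k hk h ▸ hi)

theorem reverse (hx : IsPathSeq G x m) : IsPathSeq G (fun i => x (m - i)) m := by
  refine ⟨fun i hi j hj h => ?_, fun i hi => ?_⟩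
  · have := hx.inj _ (by omega) _ (by omega) h
    omega
  · have := hx.adj (m - (i + 1)) (by omega)
    rw [show m - (i + 1) + 1 = m - i by omega] at this
    exact this.symm

theorem cons (hx : IsPathSeq G x m) {y : V} (hy : ∀ i ≤ m, x i ≠ y) (h : G.Adj y (x 0)) :
    IsPathSeq G (fun i => if i = 0 then y else x (i - 1)) (m + 1) := by
  refine ⟨fun i hi j hj hij => ?_, fun i hi => ?_⟩
  · split_ifs at hij with h1 h2 h2
    · omega
    · exact (hy _ (by omega) hij.symm).elim
    · exact (hy _ (by omega) hij).elim
    · have := hx.inj _ (by omega) _ (by omega) hij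
      omega
  · rcases i with _ | i
    · simpa using h
    · simpa using hx.adj i (by omega)

/-- A closed path may be started at any of its vertices. -/
theorem rotate (hx : IsPathSeq G x m) (h : G.Adj (x m) (x 0)) (a : ℕ) :
    IsPathSeq G (fun i => x ((a + i) % (m + 1))) m ∧
      G.Adj (x ((a + m) % (m + 1))) (x ((a + 0) % (m + 1))) := by
  have step : ∀ k, G.Adj (x (k % (m + 1))) (x ((k + 1) % (m + 1))) := by
    intro k
    have hk : k % (m + 1) < m + 1 := Nat.mod_lt _ (by omega)
    rw [Nat.add_mod]
    rcases Nat.lt_or_ge (k % (m + 1)) m with h1 | h1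
    · rw [show (k % (m + 1) + 1 % (m + 1)) % (m + 1) = k % (m + 1) + 1 by
        rw [Nat.mod_eq_of_lt (a := 1) (by omega), Nat.mod_eq_of_lt (by omega)]]
      exact hx.adj _ h1
    · have h2 : k % (m + 1) = m := by omega
      rw [h2, Nat.add_mod_mod, Nat.mod_self]
      exact h
  refine ⟨⟨fun i hi j hj hij => ?_, fun i _ => step (a + i)⟩, ?_⟩
  · have h1 := hx.inj _ (Nat.lt_succ_iff.1 (Nat.mod_lt _ (by omega))) _
      (Nat.lt_succ_iff.1 (Nat.mod_lt _ (by omega))) hij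
    have h2 : i ≡ j [MOD m + 1] := Nat.ModEq.add_left_cancel' a h1
    exact h2.eq_of_lt_of_lt (by omega) (by omega)
  · have := step (a + m)
    rwa [show a + m + 1 = a + (m + 1) by omega, Nat.add_mod_right] at this

theorem iff_of_Icc_subset (hx : IsPathSeq G x m) {I : Set ℕ} {A : V → Prop}
    (hA : ∀ v ∈ x '' I, ∀ w ∈ x '' I, G.Adj v w → A v → A w) {a b : ℕ} (hb : b ≤ m)
    (hI : ∀ i, a ≤ i → i ≤ b → i ∈ I) : ∀ i, a ≤ i → i ≤ b → (A (x i) ↔ A (x a)) := by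
  intro i hai
  induction i, hai using Nat.le_induction with
  | base => exact fun _ => Iff.rfl
  | succ i hai ih =>
    intro hi
    rw [← ih (by omega)]
    have h1 : x i ∈ x '' I := ⟨i, hI i hai (by omega), rfl⟩
    have h2 : x (i + 1) ∈ x '' I := ⟨i + 1, hI (i + 1) (by omega) hi, rfl⟩
    have h3 := hx.adj i (by omega)
    exact ⟨hA _ h2 _ h1 h3.symm, hA _ h1 _ h2 h3⟩

theorem preconnected_Icc (hx : IsPathSeq G x m) {a b : ℕ} (hb : b ≤ m) :
    (G.induce (x '' Set.Icc a b)).Preconnected := by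
  rw [induce_preconnected_iff_forall]
  rintro A hA _ ⟨i, hi, rfl⟩ _ ⟨j, hj, rfl⟩ h
  have := hx.iff_of_Icc_subset hA hb fun i h1 h2 => Set.mem_Icc.2 ⟨h1, h2⟩
  rwa [this j hj.1 hj.2, ← this i hi.1 hi.2]

/-- Two stretches of a path, linked by an edge between them, form a connected set. -/
theorem preconnected_Icc_union_Icc (hx : IsPathSeq G x m) {a b d e i₀ j₀ : ℕ} (hb : b ≤ m)
    (he : e ≤ m) (hi₀ : i₀ ∈ Set.Icc a b) (hj₀ : j₀ ∈ Set.Icc d e) (h : G.Adj (x i₀) (x j₀)) :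
    (G.induce (x '' (Set.Icc a b ∪ Set.Icc d e))).Preconnected := by
  rw [Set.image_union]
  exact (connected_induce_union (hx.preconnected_Icc hb) (hx.preconnected_Icc he)
    (Set.mem_image_of_mem x hi₀) (Set.mem_image_of_mem x hj₀) h).preconnected

theorem comp (hx : IsPathSeq G x m) {σ : ℕ → ℕ} {k : ℕ} (hσ : ∀ i ≤ k, σ i ≤ m)
    (hinj : ∀ i ≤ k, ∀ j ≤ k, σ i = σ j → i = j)
    (hadj : ∀ i < k, G.Adj (x (σ i)) (x (σ (i + 1)))) : IsPathSeq G (fun i => x (σ i)) k :=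
  ⟨fun i hi j hj h => hinj i hi j hj (hx.inj _ (hσ i hi) _ (hσ j hj) h), hadj⟩

theorem color_eq (hx : IsPathSeq G x m) {c : V → ℕ} (hc : IsTwoColoring G c) :
    ∀ i ≤ m, c (x i) = if i % 2 = 0 then c (x 0) else 3 - c (x 0) := by
  intro i
  induction i with
  | zero => simp
  | succ i ih =>
    intro hi
    have h1 := ih (by omega)
    have h2 := hc.adj_ne (hx.adj i (by omega))
    have h3 := hc.bounds (x 0)
    have h4 := hc.bounds (x (i + 1))
    split_ifs at h1 ⊢ <;> omega

theorem odd_sub_of_adj (hx : IsPathSeq G x m) {c : V → ℕ} (hc : IsTwoColoring G c) {i j : ℕ}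
    (hi : i ≤ m) (hj : j ≤ m) (h : G.Adj (x i) (x j)) : (i + j) % 2 = 1 := by
  have h1 := hx.color_eq hc i hi
  have h2 := hx.color_eq hc j hj
  have h3 := hc.adj_ne h
  have h4 := hc.bounds (x 0)
  split_ifs at h1 h2 <;> omega

end IsPathSeq

theorem IsPathSeq.rigid_of_chord {x : ℕ → V} {m : ℕ} (hx : IsPathSeq G x m) {c : V → ℕ}
    (hc : IsTwoColoring G c) {d k : ℕ} (hd : 2 ≤ d) (hdm : d + 3 ≤ m)
    (hk : k ∈ Set.Icc 2 d ∪ Set.Icc (d + 3) m)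
    (hchord : G.Adj (x d) (x m)) (h₀ : G.Adj (x 0) (x k)) : Rigid G Set.univ := by
  have hI : ∀ i ∈ Set.Icc 2 d ∪ Set.Icc (d + 3) m, i ≤ m := by
    rintro i (hi | hi)
    · exact hi.2.trans (by omega)
    · exact hi.2
  have hS := hx.preconnected_Icc_union_Icc (a := 2) (b := d) (d := d + 3) (e := m)
    (by omega) le_rfl ⟨hd, le_rfl⟩ ⟨hdm, le_rfl⟩ hchord
  refine rigid_univ_of_two_edges hc hS (t₁ := x 0) (t₂ := x 1) (r₁ := x (d + 1))
    (r₂ := x (d + 2)) (a₁ := x k) (a₂ := x 2) (b₁ := x d) (b₂ := x (d + 3))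
    ?_ ?_ ?_ ?_ ?_ ?_ ?_ ?_ (hx.adj 0 (by omega)) (hx.adj (d + 1) (by omega)) ?_ ?_ ?_ ?_
    h₀ (hx.adj 1 (by omega)) (hx.adj d (by omega)).symm (hx.adj (d + 2) (by omega))
  iterate 4
    exact hx.notMem_image hI (by omega) (by simp only [Set.mem_union, Set.mem_Icc]; omega)
  iterate 4 exact hx.ne (by omega) (by omega) (by omega)
  all_goals
    refine Set.mem_image_of_mem x ?_
    simp only [Set.mem_union, Set.mem_Icc] at hk ⊢
    omega

theorem IsPathSeq.rigid_of_interior_neighbors {x : ℕ → V} {m : ℕ} (hx : IsPathSeq G x m)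
    {c : V → ℕ} (hc : IsTwoColoring G c) {i j : ℕ} (hi : i ∈ Set.Icc 2 (m - 2))
    (hj : j ∈ Set.Icc 2 (m - 2)) (h₀ : G.Adj (x 0) (x i)) (hm : G.Adj (x m) (x j)) :
    Rigid G Set.univ := by
  have hm4 : 4 ≤ m := by
    have := hi.1.trans hi.2
    omega
  have hadj := hx.adj (m - 1) (by omega)
  have hadj' := hx.adj (m - 2) (by omega)
  rw [show m - 1 + 1 = m by omega] at hadj
  rw [show m - 2 + 1 = m - 1 by omega] at hadj'
  have hI : ∀ i ∈ Set.Icc 2 (m - 2), i ≤ m := fun i hi => hi.2.trans (by omega)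
  refine rigid_univ_of_two_edges hc (hx.preconnected_Icc (a := 2) (b := m - 2) (by omega))
    (t₁ := x 0) (t₂ := x 1) (r₁ := x (m - 1))
    (r₂ := x m) (a₁ := x i) (a₂ := x 2) (b₁ := x (m - 2)) (b₂ := x j)
    ?_ ?_ ?_ ?_ ?_ ?_ ?_ ?_ (hx.adj 0 (by omega)) hadj ?_ ?_ ?_ ?_
    h₀ (hx.adj 1 (by omega)) hadj'.symm hm
  iterate 4
    exact hx.notMem_image hI (by omega) (by simp only [Set.mem_Icc]; omega)
  iterate 4 exact hx.ne (by omega) (by omega) (by omega)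
  all_goals
    refine Set.mem_image_of_mem x ?_
    simp only [Set.mem_Icc] at hi hj ⊢
    omega

theorem IsPathSeq.rigid_of_adj_one [Fintype V] (hG : G.Connected) {x : ℕ → V} {m : ℕ}
    (hx : IsPathSeq G x m) {c : V → ℕ} (hc : IsTwoColoring G c) (hm : 5 ≤ m)
    (h₀ : G.Adj (x 0) (x (m - 1))) (h₁ : G.Adj (x m) (x 1)) : Rigid G Set.univ := by
  have hS := hx.preconnected_Icc_union_Icc (a := 0) (b := 0) (d := 4) (e := m - 1)
    (by omega) (by omega) ⟨le_rfl, le_rfl⟩ ⟨by omega, le_rfl⟩ h₀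
  have hI : ∀ i ∈ Set.Icc 0 0 ∪ Set.Icc 4 (m - 1), i ≤ m := by
    rintro i (hi | hi)
    · exact hi.2.trans (by omega)
    · exact hi.2.trans (by omega)
  have hadj := hx.adj (m - 1) (by omega)
  rw [show m - 1 + 1 = m by omega] at hadj
  refine rigid_univ_of_theta hG hc hS (u := x (m - 1)) (q := x 0) (b := x 4) (w := x 1)
    (p := x m) (t := x 3) (t' := x 2) ?_ ?_ ?_ ?_ ?_ ?_ ?_ ?_ ?_ ?_ h₀.symm
    (hx.adj 0 (by omega)) hadj.symm h₁ (hx.adj 3 (by omega)) (hx.adj 2 (by omega)).symm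
    (hx.adj 1 (by omega)).symm
  iterate 3
    refine Set.mem_image_of_mem x ?_
    simp only [Set.mem_union, Set.mem_Icc]
    omega
  iterate 4
    exact hx.notMem_image hI (by omega) (by simp only [Set.mem_union, Set.mem_Icc]; omega)
  iterate 3 exact hx.ne (by omega) (by omega) (by omega)

theorem IsPathSeq.rigid_of_adj_sub_three [Fintype V] (hG : G.Connected) {x : ℕ → V} {m : ℕ}
    (hx : IsPathSeq G x m) {c : V → ℕ} (hc : IsTwoColoring G c) (hm : 6 ≤ m)
    (h₀ : G.Adj (x 0) (x (m - 1))) (h₁ : G.Adj (x m) (x (m - 3))) : Rigid G Set.univ := by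
  obtain ⟨n, rfl⟩ : ∃ n, m = n + 6 := ⟨m - 6, by omega⟩
  have hS := hx.preconnected_Icc_union_Icc (a := 0) (b := n) (d := n + 4) (e := n + 5)
    (by omega) (by omega) ⟨le_rfl, by omega⟩ ⟨by omega, le_rfl⟩ h₀
  have hI : ∀ i ∈ Set.Icc 0 n ∪ Set.Icc (n + 4) (n + 5), i ≤ n + 6 := by
    rintro i (hi | hi)
    · exact hi.2.trans (by omega)
    · exact hi.2.trans (by omega)
  refine rigid_univ_of_theta hG hc hS (u := x (n + 5)) (q := x (n + 4)) (b := x n)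
    (w := x (n + 3)) (p := x (n + 6)) (t := x (n + 1)) (t' := x (n + 2))
    ?_ ?_ ?_ ?_ ?_ ?_ ?_ ?_ ?_ ?_ (hx.adj (n + 4) (by omega)).symm
    (hx.adj (n + 3) (by omega)).symm (hx.adj (n + 5) (by omega)).symm h₁
    (hx.adj n (by omega)).symm (hx.adj (n + 1) (by omega)) (hx.adj (n + 2) (by omega))
  iterate 3
    refine Set.mem_image_of_mem x ?_
    simp only [Set.mem_union, Set.mem_Icc]
    omega
  iterate 4
    exact hx.notMem_image hI (by omega) (by simp only [Set.mem_union, Set.mem_Icc]; omega)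
  iterate 3 exact hx.ne (by omega) (by omega) (by omega)

theorem cycleGraph_adj_iff_val {n : ℕ} {u v : Fin n} :
    (cycleGraph n).Adj u v ↔ 2 ≤ n ∧ (u.val = v.val + 1 ∨ v.val = u.val + 1 ∨
      (u.val = 0 ∧ v.val + 1 = n) ∨ (v.val = 0 ∧ u.val + 1 = n)) := by
  rw [cycleGraph_adj']
  have hu := u.isLt
  have hv := v.isLt
  rcases lt_trichotomy u v with h | h | h
  · rw [Fin.coe_sub_iff_lt.2 h, Fin.sub_val_of_le h.le]
    rw [Fin.lt_def] at h
    omega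
  · subst h
    simp only [Fin.sub_val_of_le le_rfl]
    omega
  · rw [Fin.coe_sub_iff_lt.2 h, Fin.sub_val_of_le h.le]
    rw [Fin.lt_def] at h
    omega

theorem IsPathSeq.rigid_or_cycle {x : ℕ → V} {m : ℕ} (hx : IsPathSeq G x m) {c : V → ℕ}
    (hc : IsTwoColoring G c) (hm : 2 ≤ m) (hspan : ∀ v, ∃ i ≤ m, x i = v)
    (hclosed : G.Adj (x m) (x 0)) :
    Rigid G Set.univ ∨ Nonempty (G ≃g cycleGraph (m + 1)) := by
  have hodd := hx.odd_sub_of_adj hc le_rfl (Nat.zero_le m) hclosed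
  by_cases hch : ∃ a b, a + 2 ≤ b ∧ b ≤ m ∧ ¬ (a = 0 ∧ b = m) ∧ G.Adj (x a) (x b)
  · left
    obtain ⟨a, b, hab, hb, hne, h⟩ := hch
    have hpar := hx.odd_sub_of_adj hc (by omega) hb h
    obtain ⟨hz, hz'⟩ := hx.rotate hclosed (b + 1)
    have e1 : (b + 1 + m) % (m + 1) = b := by
      rw [show b + 1 + m = b + (m + 1) by omega, Nat.add_mod_right, Nat.mod_eq_of_lt (by omega)]
    have e2 : (b + 1 + (m - (b - a))) % (m + 1) = a := by
      rw [show b + 1 + (m - (b - a)) = a + (m + 1) by omega, Nat.add_mod_right,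
        Nat.mod_eq_of_lt (by omega)]
    refine hz.rigid_of_chord hc (d := m - (b - a)) (k := m) (by omega) (by omega)
      (Or.inr ⟨by omega, le_rfl⟩) ?_ hz'.symm
    rwa [e1, e2]
  · right
    push Not at hch
    let f : Fin (m + 1) → V := fun i => x i
    have hf : Function.Bijective f := by
      constructor
      · intro i j hij
        exact Fin.ext (hx.inj _ (by omega) _ (by omega) hij)
      · intro v
        obtain ⟨i, hi, rfl⟩ := hspan v
        exact ⟨⟨i, by omega⟩, rfl⟩
    refine ⟨(RelIso.mk (Equiv.ofBijective f hf) ?_ : cycleGraph (m + 1) ≃g G).symm⟩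
    intro i j
    rw [cycleGraph_adj_iff_val]
    change G.Adj (x i) (x j) ↔ _
    have hi := i.isLt
    have hj := j.isLt
    constructor
    · intro h
      have hij : (i : ℕ) ≠ j := fun e => G.loopless.irrefl _ (e ▸ h)
      have h1 := hch i j
      have h2 := hch j i
      simp only [h, h.symm, not_true_eq_false, imp_false] at h1 h2
      omega
    · rintro ⟨-, h | h | ⟨h, h'⟩ | ⟨h, h'⟩⟩
      · rw [h]
        exact (hx.adj j (by omega)).symm
      · rw [h]
        exact hx.adj i (by omega)
      · rw [h, show (j : ℕ) = m by omega]
        exact hclosed.symm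
      · rw [h, show (i : ℕ) = m by omega]
        exact hclosed

theorem exists_longest_pathSeq [Fintype V] [Nonempty V] (G : SimpleGraph V) :
    ∃ m, (∃ x, IsPathSeq G x m) ∧ ¬ ∃ x, IsPathSeq G x (m + 1) := by
  by_contra! h
  have hall : ∀ m, ∃ x, IsPathSeq G x m := by
    intro m
    induction m with
    | zero =>
      exact ⟨fun _ => Classical.arbitrary V, fun i hi j hj _ => by omega, fun i hi => by omega⟩
    | succ m ih => exact h m ih
  obtain ⟨x, hx⟩ := hall (Fintype.card V)
  have := Fintype.card_le_of_injective (fun i : Fin (Fintype.card V + 1) => x i)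
    fun i j hij => Fin.ext (hx.inj _ (by omega) _ (by omega) hij)
  simp at this

theorem IsPathSeq.exists_eq_of_adj_zero {x : ℕ → V} {m : ℕ} (hx : IsPathSeq G x m)
    (hmax : ¬ ∃ x, IsPathSeq G x (m + 1)) {y : V} (h : G.Adj (x 0) y) : ∃ i ≤ m, x i = y := by
  by_contra! hy
  exact hmax ⟨_, hx.cons hy h.symm⟩

/-- A longest path with adjacent ends meets every vertex. -/
theorem IsPathSeq.exists_eq_of_closed {x : ℕ → V} {m : ℕ} (hG : G.Connected)
    (hx : IsPathSeq G x m) (hmax : ¬ ∃ x, IsPathSeq G x (m + 1)) (hclosed : G.Adj (x m) (x 0))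
    (v : V) : ∃ i ≤ m, x i = v := by
  by_contra hv
  obtain ⟨p⟩ := hG.preconnected (x 0) v
  obtain ⟨d, -, ⟨i, hi, hd1⟩, hd2⟩ :=
    p.exists_boundary_dart {u | ∃ i ≤ m, x i = u} ⟨0, Nat.zero_le m, rfl⟩ hv
  obtain ⟨hz, -⟩ := hx.rotate hclosed i
  have h0 : x ((i + 0) % (m + 1)) = d.fst := by
    rw [add_zero, Nat.mod_eq_of_lt (by omega), hd1]
  obtain ⟨j, hj, hj'⟩ := hz.exists_eq_of_adj_zero hmax (y := d.snd) (h0 ▸ d.adj)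
  exact hd2 ⟨_, Nat.lt_succ_iff.1 (Nat.mod_lt _ (by omega)), hj'⟩

theorem IsPathSeq.rigid_or_completeBipartite {x : ℕ → V} (hG : G.Connected)
    (hx : IsPathSeq G x 4) (hmax : ¬ ∃ x, IsPathSeq G x 5) {c : V → ℕ}
    (hc : IsTwoColoring G c) (hdeg : ∀ v w, ∃ u, u ≠ w ∧ G.Adj v u)
    (h₀ : G.Adj (x 0) (x 3)) (h₁ : G.Adj (x 4) (x 1)) :
    Rigid G Set.univ ∨ Nonempty (G ≃g completeBipartiteGraph (Fin 2) (Fin 3)) := by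
  have a01 := hx.adj 0 (by omega)
  have a12 := hx.adj 1 (by omega)
  have a23 := hx.adj 2 (by omega)
  have a34 := hx.adj 3 (by omega)
  norm_num at a01 a12 a23 a34
  by_cases hspan : ∀ v, ∃ i ≤ 4, x i = v
  · right
    let σ : Fin 2 ⊕ Fin 3 → ℕ := Sum.elim ![1, 3] ![0, 2, 4]
    have hσ : ∀ s, σ s ≤ 4 := by decide
    have hσ' : ∀ s t, σ s = σ t → s = t := by decide
    let f : Fin 2 ⊕ Fin 3 → V := fun s => x (σ s)
    have hf : Function.Bijective f := by
      refine ⟨fun s t h => hσ' s t (hx.inj _ (hσ s) _ (hσ t) h), fun v => ?_⟩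
      obtain ⟨i, hi, rfl⟩ := hspan v
      have : ∀ i ≤ 4, ∃ s, σ s = i := by decide
      obtain ⟨s, hs⟩ := this i hi
      exact ⟨s, congrArg x hs⟩
    refine ⟨(RelIso.mk (Equiv.ofBijective f hf) ?_ :
      completeBipartiteGraph (Fin 2) (Fin 3) ≃g G).symm⟩
    intro s t
    change G.Adj (x (σ s)) (x (σ t)) ↔ _
    constructor
    · intro h
      have h1 := hx.odd_sub_of_adj hc (hσ s) (hσ t) h
      have : ∀ s t, (σ s + σ t) % 2 = 1 → (completeBipartiteGraph (Fin 2) (Fin 3)).Adj s t := by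
        unfold completeBipartiteGraph
        decide
      exact this s t h1
    · have hlr : ∀ (i : Fin 2) (j : Fin 3), G.Adj (x (σ (Sum.inl i))) (x (σ (Sum.inr j))) := by
        intro i j
        fin_cases i <;> fin_cases j
        · exact a01.symm
        · exact a12
        · exact h₁.symm
        · exact h₀.symm
        · exact a23.symm
        · exact a34
      rcases s with i | i <;> rcases t with j | j <;> intro h
      · simp at h
      · exact hlr i j
      · exact (hlr j i).symm
      · simp at h
  · left
    obtain ⟨v, hv⟩ := not_forall.1 hspan
    obtain ⟨p⟩ := hG.preconnected (x 0) v
    obtain ⟨d, -, ⟨i, hi, hd1⟩, hd2⟩ :=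
      p.exists_boundary_dart {u | ∃ i ≤ 4, x i = u} ⟨0, Nat.zero_le 4, rfl⟩ hv
    have hout : ∀ y, (¬ ∃ i ≤ 4, x i = y) →
        ¬ G.Adj (x 0) y ∧ ¬ G.Adj (x 2) y ∧ ¬ G.Adj (x 4) y := by
      intro y hy
      refine ⟨fun h => hy (hx.exists_eq_of_adj_zero hmax h), fun h => ?_, fun h => ?_⟩
      · have hz : IsPathSeq G (fun i => x ([2, 1, 0, 3, 4].getD i 0)) 4 :=
          hx.comp (by decide) (by decide) fun i hi => by
            interval_cases i
            · exact a12.symm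
            · exact a01.symm
            · exact h₀
            · exact a34
        obtain ⟨j, hj, hj'⟩ := hz.exists_eq_of_adj_zero hmax h
        have : ∀ i ≤ 4, [2, 1, 0, 3, 4].getD i 0 ≤ 4 := by decide
        exact hy ⟨_, this j hj, hj'⟩
      · obtain ⟨j, hj, hj'⟩ := hx.reverse.exists_eq_of_adj_zero hmax h
        exact hy ⟨4 - j, by omega, hj'⟩
    have hcommon : ∀ y, (¬ ∃ i ≤ 4, x i = y) → G.Adj y (x 1) ∨ G.Adj y (x 3) →
        G.Adj y (x 1) ∧ G.Adj y (x 3) := by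
      intro y hy hadj
      have key : ∀ a b e f : ℕ, a ≤ 4 → b ≤ 4 → e ≤ 4 → f ≤ 4 → [a, b, e, f].Nodup →
          G.Adj y (x a) → G.Adj (x a) (x b) → G.Adj (x b) (x e) → G.Adj (x e) (x f) →
          ∃ j ≤ 4, j ≠ a ∧ G.Adj y (x j) := by
        intro a b e f ha hb he hf hnd hya hab hbe hef
        obtain ⟨z, hza, hyz⟩ := hdeg y (x a)
        have hz : IsPathSeq G (fun i => x ([a, b, e, f].getD i 0)) 3 := by
          simp only [List.nodup_cons, List.mem_cons, List.not_mem_nil, or_false, not_or,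
            not_false_eq_true, List.nodup_nil, and_true] at hnd
          refine hx.comp (fun i hi => ?_) (fun i hi j hj hij => ?_) fun i hi => ?_
          · interval_cases i <;> simpa
          · interval_cases i <;> interval_cases j <;> simp at hij ⊢ <;> omega
          · interval_cases i <;> simpa
        have hle : ∀ i ≤ 3, [a, b, e, f].getD i 0 ≤ 4 := by
          intro i hi
          interval_cases i <;> simpa
        have hz' := hz.cons (y := y) (fun i hi h => hy ⟨_, hle i hi, h⟩) hya
        obtain ⟨j, hj, hj'⟩ := hz'.exists_eq_of_adj_zero hmax (y := z) hyz
        split_ifs at hj' with hj0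
        · exact (hyz.ne hj').elim
        · refine ⟨_, hle (j - 1) (by omega), ?_, hj' ▸ hyz⟩
          rintro h
          exact hza (by rw [← hj', h])
      have hnot := hout y hy
      have hev : ∀ j ≤ 4, G.Adj y (x j) → j = 1 ∨ j = 3 := by
        intro j hj h
        interval_cases j
        · exact (hnot.1 h.symm).elim
        · simp
        · exact (hnot.2.1 h.symm).elim
        · simp
        · exact (hnot.2.2 h.symm).elim
      rcases hadj with h | h
      · obtain ⟨j, hj, hja, hyj⟩ := key 1 0 3 2 (by omega) (by omega) (by omega) (by omega)
          (by decide) h a01.symm h₀ a23.symm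
        have : j = 3 := by
          have := hev j hj hyj
          omega
        exact ⟨h, this ▸ hyj⟩
      · obtain ⟨j, hj, hja, hyj⟩ := key 3 0 1 2 (by omega) (by omega) (by omega) (by omega)
          (by decide) h h₀.symm a01 a12
        have : j = 1 := by
          have := hev j hj hyj
          omega
        exact ⟨this ▸ hyj, h⟩
    have hd := d.adj
    rw [← hd1] at hd
    have hnot := hout d.snd hd2
    have hor : G.Adj d.snd (x 1) ∨ G.Adj d.snd (x 3) := by
      interval_cases i
      · exact (hnot.1 hd).elim
      · exact Or.inl hd.symm
      · exact (hnot.2.1 hd).elim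
      · exact Or.inr hd.symm
      · exact (hnot.2.2 hd).elim
    obtain ⟨hy1, hy3⟩ := hcommon d.snd hd2 hor
    have hne : ∀ i ≤ 4, x i ≠ d.snd := fun i hi h => hd2 ⟨i, hi, h⟩
    exact rigid_univ_of_four_common_neighbors (u := x 1) (w := x 3) (p₁ := x 0) (p₂ := x 2)
      (p₃ := x 4) (p₄ := d.snd) (hx.ne (by omega) (by omega) (by omega))
      (hx.ne (by omega) (by omega) (by omega)) (hx.ne (by omega) (by omega) (by omega))
      (hne 0 (by omega)) (hx.ne (by omega) (by omega) (by omega)) (hne 2 (by omega))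
      (hne 4 (by omega)) a01.symm a12 h₁.symm hy1.symm h₀.symm a23.symm a34 hy3.symm

theorem rigid_or_cycle_or_completeBipartite [Fintype V] (hG : G.Connected) {c : V → ℕ}
    (hc : IsTwoColoring G c) (hdeg : ∀ v w, ∃ u, u ≠ w ∧ G.Adj v u) :
    Rigid G Set.univ ∨ (∃ m, 3 ≤ m ∧ Nonempty (G ≃g cycleGraph m)) ∨
      Nonempty (G ≃g completeBipartiteGraph (Fin 2) (Fin 3)) := by
  have := hG.nonempty
  obtain ⟨m, ⟨x, hx⟩, hmax⟩ := exists_longest_pathSeq G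
  have hnbr : ∀ x, IsPathSeq G x m →
      ∃ i, 3 ≤ i ∧ i ≤ m ∧ i % 2 = 1 ∧ G.Adj (x 0) (x i) := by
    intro x hx
    obtain ⟨u, hu, hadj⟩ := hdeg (x 0) (x 1)
    obtain ⟨i, hi, rfl⟩ := hx.exists_eq_of_adj_zero hmax hadj
    have h1 := hx.odd_sub_of_adj hc (Nat.zero_le m) hi hadj
    have h2 : i ≠ 1 := fun h => hu (h ▸ rfl)
    exact ⟨i, by omega, hi, by omega, hadj⟩
  by_cases hclosed : G.Adj (x m) (x 0)
  · obtain ⟨i, hi, him, -⟩ := hnbr x hx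
    rcases hx.rigid_or_cycle hc (by omega) (hx.exists_eq_of_closed hG hmax hclosed) hclosed with
      h | h
    · exact Or.inl h
    · exact Or.inr (Or.inl ⟨m + 1, by omega, h⟩)
  have main : ∀ x, IsPathSeq G x m → ¬ G.Adj (x m) (x 0) → G.Adj (x 0) (x (m - 1)) →
      Rigid G Set.univ ∨ Nonempty (G ≃g completeBipartiteGraph (Fin 2) (Fin 3)) := by
    intro x hx hclosed h₀
    obtain ⟨k, hk, hkm, hk2, hadj⟩ := hnbr _ hx.reverse
    rw [Nat.sub_zero] at hadj
    have hkm' : k ≠ m := by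
      rintro rfl
      rw [Nat.sub_self] at hadj
      exact hclosed hadj
    have hm2 := hx.odd_sub_of_adj hc (Nat.zero_le m) (by omega) h₀
    obtain ⟨j, hj⟩ : ∃ j, j = m - k := ⟨_, rfl⟩
    rw [← hj] at hadj
    rcases Nat.lt_or_ge m 5 with hm | hm
    · obtain rfl : m = 4 := by omega
      obtain rfl : j = 1 := by omega
      exact hx.rigid_or_completeBipartite hG hmax hc hdeg h₀ hadj
    · left
      by_cases hj1 : j = 1
      · subst hj1
        exact hx.rigid_of_adj_one hG hc hm h₀ hadj
      by_cases hj3 : j = m - 3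
      · subst hj3
        exact hx.rigid_of_adj_sub_three hG hc (by omega) h₀ hadj
      exact hx.rigid_of_chord hc (d := j) (k := m - 1) (by omega) (by omega)
        (Or.inr ⟨by omega, by omega⟩) hadj.symm h₀
  obtain ⟨i, hi, him, hi2, hadj⟩ := hnbr x hx
  obtain ⟨k, hk, hkm, hk2, hadj'⟩ := hnbr _ hx.reverse
  rw [Nat.sub_zero] at hadj'
  have him' : i ≠ m := by
    rintro rfl
    exact hclosed hadj.symm
  have hkm' : k ≠ m := by
    rintro rfl
    rw [Nat.sub_self] at hadj'
    exact hclosed hadj'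
  by_cases hi1 : i = m - 1
  · subst hi1
    exact (main x hx hclosed hadj).imp_right Or.inr
  by_cases hk1 : k = m - 1
  · subst hk1
    refine (main _ hx.reverse ?_ ?_).imp_right Or.inr
    · rw [Nat.sub_self, Nat.sub_zero]
      exact fun h => hclosed h.symm
    · rwa [Nat.sub_zero]
  · exact Or.inl (hx.rigid_of_interior_neighbors hc (i := i) (j := m - k) ⟨by omega, by omega⟩
      ⟨by omega, by omega⟩ hadj hadj')

/-- `e` is a coloring from the lists `L` of the cycle with vertices `0, …, m - 1`. -/
structure IsCyclicColoring (m : ℕ) (L : ℕ → Finset ℕ) (e : ℕ → ℕ) : Prop where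
  mem : ∀ i < m, e i ∈ L i
  ne : ∀ i, i + 1 < m → e i ≠ e (i + 1)
  last_ne : e (m - 1) ≠ e 0

theorem exists_greedy_coloring {L : ℕ → Finset ℕ} (hL : ∀ i, (L i).card = 2) (a : ℕ) :
    ∃ e : ℕ → ℕ, e 0 = a ∧ ∀ i, e (i + 1) ∈ L (i + 1) ∧ e i ≠ e (i + 1) := by
  choose p hp hp' using fun i x => (L i).exists_mem_ne (by rw [hL]; norm_num) x
  exact ⟨fun i => Nat.rec a (fun j x => p (j + 1) x) i, rfl, fun i => ⟨hp _ _, (hp' _ _).symm⟩⟩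

/-- A cycle of even length whose lists at `0` and `m - 1` differ has two colorings. -/
theorem exists_two_cyclicColoring {m : ℕ} (hm : 3 ≤ m) (heven : Even m) {L : ℕ → Finset ℕ}
    (hL : ∀ i, (L i).card = 2) (hne : L 0 ≠ L (m - 1)) :
    ∃ e e', IsCyclicColoring m L e ∧ IsCyclicColoring m L e' ∧ ∃ i < m, e i ≠ e' i := by
  obtain ⟨a, ha, ha'⟩ : ∃ a ∈ L 0, a ∉ L (m - 1) := by
    by_contra! h
    exact hne (Finset.eq_of_subset_of_card_le h (by rw [hL, hL]))
  obtain ⟨e, he0, he⟩ := exists_greedy_coloring hL a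
  have hmem : ∀ i, e i ∈ L i := by
    rintro (_ | i)
    · rwa [he0]
    · exact (he i).1
  have hlast : ∀ y ∈ L (m - 1), y ≠ a := fun y hy h => ha' (h ▸ hy)
  have hval : IsCyclicColoring m L e :=
    ⟨fun i _ => hmem i, fun i _ => (he i).2, by rw [he0]; exact hlast _ (hmem _)⟩
  by_contra hcon
  have hcon' : ∀ e', IsCyclicColoring m L e' → ∀ i < m, e i = e' i := by
    intro e' he' i hi
    by_contra h
    exact hcon ⟨e, e', hval, he', i, hi, h⟩
  have hstep : ∀ i, i + 1 < m → e i ∈ L (i + 1) := by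
    intro i hi
    obtain ⟨y, hy, hye⟩ := (L (i + 1)).exists_mem_ne (by rw [hL]; norm_num) (e (i + 1))
    by_contra hi'
    have hyi : e i ≠ y := fun h => hi' (h ▸ hy)
    obtain ⟨g, hg0, hg⟩ := exists_greedy_coloring (L := fun j => L (i + 1 + j)) (fun _ => hL _) y
    have hgmem : ∀ j, i < j → g (j - (i + 1)) ∈ L j := by
      intro j hj
      obtain ⟨t, rfl⟩ := Nat.exists_eq_add_of_le (Nat.succ_le_of_lt hj)
      rw [Nat.succ_eq_add_one, Nat.add_sub_cancel_left]
      rcases t with _ | t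
      · rwa [hg0]
      · exact (hg t).1
    have hmem' : ∀ j, (if j ≤ i then e j else g (j - (i + 1))) ∈ L j := by
      intro j
      split_ifs with h
      · exact hmem j
      · exact hgmem j (by omega)
    have := hcon' (fun j => if j ≤ i then e j else g (j - (i + 1)))
      ⟨fun j _ => hmem' j, fun j hj => ?_, ?_⟩ (i + 1) hi
    · simp only [show ¬ i + 1 ≤ i by omega, if_false, Nat.sub_self, hg0] at this
      exact hye this.symm
    · rcases lt_trichotomy j i with h | rfl | h
      · simp only [show j ≤ i by omega, show j + 1 ≤ i by omega, if_true]
        exact (he j).2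
      · simpa [hg0] using hyi
      · simp only [show ¬ j ≤ i by omega, show ¬ j + 1 ≤ i by omega, if_false]
        rw [show j + 1 - (i + 1) = j - (i + 1) + 1 by omega]
        exact (hg _).2
    · simp only [Nat.zero_le, if_true, he0]
      exact hlast _ (hmem' _)
  obtain ⟨s, hs, hsa⟩ := (L 0).exists_mem_ne (by rw [hL]; norm_num) a
  have hshift : ∀ k, 1 ≤ k → k ≤ m → (k = 1 → s ≠ e 1) → (2 ≤ k → k < m → e (k - 2) ≠ e k) →
      (k < m → s ≠ e (m - 1)) → (k = m → s ≠ e (m - 2)) → False := by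
    intro k hk hkm h1 h2 h3 h4
    have := hcon' (fun i => if i = 0 then s else if i < k then e (i - 1) else e i)
      ⟨fun i hi => ?_, fun i hi => ?_, ?_⟩ 0 (by omega)
    · exact hsa (by rw [← he0, this]; rfl)
    · split_ifs with h h'
      · rwa [h]
      · have := hstep (i - 1) (by omega)
        rwa [show i - 1 + 1 = i by omega] at this
      · exact hmem i
    · have := (he i).2
      rcases i with _ | i
      · simp only [if_true, Nat.zero_add, one_ne_zero, if_false, Nat.sub_self, he0]
        split_ifs with h
        · exact hsa
        · exact h1 (by omega)
      · simp only [Nat.succ_ne_zero, if_false, Nat.add_sub_cancel]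
        split_ifs with h h'
        · exact (he i).2
        · have := h2 (by omega) (by omega)
          rwa [show k = i + 2 by omega] at this
        · omega
        · exact this
    · simp only [show m - 1 ≠ 0 by omega, if_false, if_true]
      split_ifs with h
      · exact (h4 (by omega)).symm
      · exact (h3 (by omega)).symm
  have hs2 : s = e (m - 2) := by
    by_contra h
    exact hshift m (by omega) le_rfl (by omega) (by omega) (by omega) fun _ => h
  have hs1 : s ≠ e (m - 1) := by
    have := (he (m - 2)).2
    rwa [← hs2, show m - 2 + 1 = m - 1 by omega] at this
  have hper : ∀ k, k + 2 < m → e (k + 2) = e k := by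
    intro k hk
    by_contra h
    exact hshift (k + 2) (by omega) hk.le (by omega) (fun _ _ => Ne.symm h) (fun _ => hs1)
      (by omega)
  have heq : ∀ k, 2 * k < m → e (2 * k) = a := by
    intro k
    induction k with
    | zero => intro _; exact he0
    | succ k ih => intro h; rw [← ih (by omega)]; exact hper _ (by omega)
  obtain ⟨r, hr⟩ := heven
  refine hsa ?_
  rw [hs2, show m - 2 = 2 * (r - 1) by omega]
  exact heq _ (by omega)

theorem not_rigid_cycleGraph {m : ℕ} (hm : 3 ≤ m) (heven : Even m) :
    ¬ Rigid (cycleGraph m) Set.univ := by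
  rintro ⟨L, hL, huniq⟩
  by_cases hall : ∃ r : Fin m,
      L r ≠ L ⟨if r.val = 0 then m - 1 else r.val - 1, by split_ifs <;> omega⟩
  · obtain ⟨⟨r, hr⟩, hne⟩ := hall
    set M : ℕ → Finset ℕ := fun j => if h : j + r < m then L ⟨j + r, h⟩ else
      if h : j + r - m < m then L ⟨j + r - m, h⟩ else {1, 2} with hM
    have hMcard : ∀ j, (M j).card = 2 := by
      intro j
      simp only [hM]
      split_ifs
      · exact hL _
      · exact hL _
      · rfl
    have key : ∀ e, IsCyclicColoring m M e → IsListColoringOn (cycleGraph m) L Set.univ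
        (fun v => if r ≤ v.val then e (v.val - r) else e (v.val + m - r)) := by
      intro e he
      refine ⟨fun v _ => ?_, ?_⟩
      · have := v.isLt
        split_ifs with h
        · have := he.mem (v.val - r) (by omega)
          simpa [hM, h] using this
        · have := he.mem (v.val + m - r) (by omega)
          have e1 : v.val + m - r + r = v.val + m := by omega
          simpa [hM, e1] using this
      · have succ_ne : ∀ v w : Fin m, w.val = v.val + 1 ∨ (w.val = 0 ∧ v.val + 1 = m) →
            (if r ≤ v.val then e (v.val - r) else e (v.val + m - r)) ≠
            (if r ≤ w.val then e (w.val - r) else e (w.val + m - r)) := by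
          intro v w h
          have := v.isLt
          have := w.isLt
          rcases h with h | ⟨h, h'⟩
          · split_ifs with h1 h2 h2
            · have := he.ne (v.val - r) (by omega)
              rwa [show v.val - r + 1 = w.val - r by omega] at this
            · omega
            · have := he.last_ne
              rwa [show m - 1 = v.val + m - r by omega, show 0 = w.val - r by omega] at this
            · have := he.ne (v.val + m - r) (by omega)
              rwa [show v.val + m - r + 1 = w.val + m - r by omega] at this
          · split_ifs with h1 h2 h2
            · have := he.last_ne
              rwa [show m - 1 = v.val - r by omega, show 0 = w.val - r by omega] at this
            · have := he.ne (v.val - r) (by omega)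
              rwa [show v.val - r + 1 = w.val + m - r by omega] at this
            · omega
            · omega
        intro v _ w _ hvw
        rcases (cycleGraph_adj_iff_val.1 hvw).2 with h | h | h | h
        · exact (succ_ne w v (Or.inl h)).symm
        · exact succ_ne v w (Or.inl h)
        · exact (succ_ne w v (Or.inr h)).symm
        · exact succ_ne v w (Or.inr h)
    obtain ⟨e, e', he, he', i, hi, hee⟩ := exists_two_cyclicColoring hm heven hMcard (by
      rcases Nat.eq_zero_or_pos r with rfl | h0
      · have h1 : 0 < m := by omega
        simpa [hM, h1] using hne
      · have h1 : ¬ m - 1 + r < m := by omega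
        have h2 : m - 1 + r - m = r - 1 := by omega
        have h3 : r - 1 < m := by omega
        simpa [hM, hr, h0.ne', h1, h2, h3] using hne)
    refine hee ?_
    by_cases h : i + r < m
    · have := huniq _ _ (key e he) (key e' he') (Set.mem_univ ⟨i + r, h⟩)
      simpa using this
    · have := huniq _ _ (key e he) (key e' he') (Set.mem_univ ⟨i + r - m, by omega⟩)
      have e1 : ¬ r ≤ i + r - m := by omega
      have e2 : i + r - m + m - r = i := by omega
      simpa only [e1, if_false, e2] using this
  · push Not at hall
    have h0 : ∀ i (hi : i < m), L ⟨i, hi⟩ = L ⟨0, by omega⟩ := by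
      intro i
      induction i with
      | zero => exact fun _ => rfl
      | succ i ih =>
        intro hi
        rw [← ih (by omega), hall ⟨i + 1, hi⟩]
        simp
    obtain ⟨a, b, hab, hLab⟩ := Finset.card_eq_two.1 (hL ⟨0, by omega⟩)
    have key : ∀ a b : ℕ, a ≠ b → L ⟨0, by omega⟩ = {a, b} →
        IsListColoringOn (cycleGraph m) L Set.univ fun v => if v.val % 2 = 0 then a else b := by
      intro a b hab hLab
      refine ⟨fun v _ => ?_, fun v _ w _ h => ?_⟩
      · rw [h0 v.val v.isLt, hLab]
        split_ifs <;> simp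
      · have h' := (cycleGraph_adj_iff_val.1 h).2
        obtain ⟨r, hr⟩ := heven
        split_ifs with h1 h2 h2
        · omega
        · exact hab
        · exact hab.symm
        · omega
    have := huniq _ _ (key a b hab hLab) (key b a hab.symm (by rw [hLab, Finset.pair_comm]))
      (Set.mem_univ ⟨0, by omega⟩)
    exact hab (by simpa using this)

theorem not_rigid_completeBipartiteGraph :
    ¬ Rigid (completeBipartiteGraph (Fin 2) (Fin 3)) Set.univ := by
  rintro ⟨L, hL, huniq⟩
  have key : ∀ x ∈ L (Sum.inl 0), ∀ y ∈ L (Sum.inl 1), ∀ t : Fin 3 → ℕ,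
      (∀ i, t i ∈ L (Sum.inr i) ∧ t i ≠ x ∧ t i ≠ y) →
      IsListColoringOn (completeBipartiteGraph (Fin 2) (Fin 3)) L Set.univ
        (Sum.elim ![x, y] t) := by
    intro x hx y hy t ht
    constructor
    · rintro (v | v) -
      · fin_cases v
        · exact hx
        · exact hy
      · exact (ht v).1
    · have main : ∀ (j : Fin 2) (i : Fin 3), (![x, y] : Fin 2 → ℕ) j ≠ t i := by
        intro j i
        fin_cases j
        · exact (ht i).2.1.symm
        · exact (ht i).2.2.symm
      rintro (v | v) - (w | w) - h
      · simp at h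
      · exact main v w
      · exact (main w v).symm
      · simp at h
  have other : ∀ v x, ∃ y ∈ L v, y ≠ x := fun v x =>
    (L v).exists_mem_ne (by rw [hL]; norm_num) x
  set good : ℕ → ℕ → Prop := fun x y => ∀ i, ∃ z ∈ L (Sum.inr i), z ≠ x ∧ z ≠ y with hgood
  have pair_uniq : ∀ x ∈ L (Sum.inl 0), ∀ y ∈ L (Sum.inl 1), ∀ x' ∈ L (Sum.inl 0),
      ∀ y' ∈ L (Sum.inl 1), good x y → good x' y' → x = x' ∧ y = y' := by
    intro x hx y hy x' hx' y' hy' h h'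
    choose t ht using h
    choose t' ht' using h'
    have := huniq _ _ (key x hx y hy t ht) (key x' hx' y' hy' t' ht')
    exact ⟨this (Set.mem_univ (Sum.inl 0)), this (Set.mem_univ (Sum.inl 1))⟩
  have third_uniq : ∀ x ∈ L (Sum.inl 0), ∀ y ∈ L (Sum.inl 1), good x y →
      ∀ i, ∀ z ∈ L (Sum.inr i), ∀ z' ∈ L (Sum.inr i), z ≠ x → z ≠ y → z' ≠ x → z' ≠ y →
      z = z' := by
    intro x hx y hy h i z hz z' hz' h1 h2 h3 h4
    choose t ht using h
    have hupd : ∀ u ∈ L (Sum.inr i), u ≠ x → u ≠ y → ∀ j,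
        Function.update t i u j ∈ L (Sum.inr j) ∧ Function.update t i u j ≠ x ∧
          Function.update t i u j ≠ y := by
      intro u hu hux huy j
      rcases eq_or_ne j i with rfl | hj
      · simpa using ⟨hu, hux, huy⟩
      · simpa [Function.update_of_ne hj] using ht j
    have := huniq _ _ (key x hx y hy _ (hupd z hz h1 h2)) (key x hx y hy _ (hupd z' hz' h3 h4))
      (Set.mem_univ (Sum.inr i))
    simpa using this
  by_cases hint : ∃ a ∈ L (Sum.inl 0), a ∈ L (Sum.inl 1)
  · obtain ⟨a, ha, ha'⟩ := hint
    have haa : good a a := fun i => by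
      obtain ⟨z, hz, hza⟩ := other (Sum.inr i) a
      exact ⟨z, hz, hza, hza⟩
    have hmem : ∀ i, a ∈ L (Sum.inr i) := by
      intro i
      by_contra h
      obtain ⟨z, hz, hza⟩ := other (Sum.inr i) a
      obtain ⟨z', hz', hzz⟩ := other (Sum.inr i) z
      exact hzz (third_uniq a ha a ha' haa i z' hz' z hz (fun e => h (e ▸ hz'))
        (fun e => h (e ▸ hz')) hza hza)
    obtain ⟨b, hb, hba⟩ := other (Sum.inl 0) a
    obtain ⟨d, hd, hda⟩ := other (Sum.inl 1) a
    exact hba (pair_uniq b hb d hd a ha a ha' (fun i => ⟨a, hmem i, hba.symm, hda.symm⟩) haa).1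
  · push Not at hint
    have three : ∀ a ∈ L (Sum.inl 0), ∀ b ∈ L (Sum.inl 0), ∀ c ∈ L (Sum.inl 1),
        ∀ d ∈ L (Sum.inl 1), a ≠ b → c ≠ d → ¬ good a c → ¬ good a d → good b c := by
      intro a ha b hb c hc d hd hab hcd h1 h2
      by_contra h3
      have hac : a ≠ c := fun h => hint a ha (h ▸ hc)
      have had : a ≠ d := fun h => hint a ha (h ▸ hd)
      have hbc : b ≠ c := fun h => hint b hb (h ▸ hc)
      have hbd : b ≠ d := fun h => hint b hb (h ▸ hd)
      have bad : ∀ x y, ¬ good x y → ∃ i, ∀ z ∈ L (Sum.inr i), z = x ∨ z = y := by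
        intro x y h
        simp only [hgood] at h
        push Not at h
        obtain ⟨i, hi⟩ := h
        exact ⟨i, fun z hz => or_iff_not_imp_left.2 (hi z hz)⟩
      obtain ⟨i, hi⟩ := bad a c h1
      obtain ⟨j, hj⟩ := bad a d h2
      obtain ⟨k, hk⟩ := bad b c h3
      have hij : i ≠ j := by
        rintro rfl
        obtain ⟨z, hz, hza⟩ := other (Sum.inr i) a
        exact hcd (((hi z hz).resolve_left hza).symm.trans ((hj z hz).resolve_left hza))
      have hik : i ≠ k := by
        rintro rfl
        obtain ⟨z, hz, hzc⟩ := other (Sum.inr i) c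
        exact hab (((hi z hz).resolve_right hzc).symm.trans ((hk z hz).resolve_right hzc))
      have hjk : j ≠ k := by
        rintro rfl
        obtain ⟨z, hz, -⟩ := other (Sum.inr j) a
        rcases hj z hz with h | h <;> rcases hk z hz with h' | h' <;> omega
      have hcover : ∀ l, l = i ∨ l = j ∨ l = k := by omega
      have hgbd : good b d := by
        intro l
        rcases hcover l with rfl | rfl | rfl
        · obtain ⟨z, hz, -⟩ := other (Sum.inr l) a
          exact ⟨z, hz, by have := hi z hz; omega, by have := hi z hz; omega⟩
        · obtain ⟨z, hz, hzd⟩ := other (Sum.inr l) d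
          exact ⟨z, hz, by have := hj z hz; omega, hzd⟩
        · obtain ⟨z, hz, hzb⟩ := other (Sum.inr l) b
          exact ⟨z, hz, hzb, by have := hk z hz; omega⟩
      obtain ⟨z, hz, -⟩ := other (Sum.inr i) a
      obtain ⟨z', hz', hzz⟩ := other (Sum.inr i) z
      have := hi z hz
      have := hi z' hz'
      exact hzz (third_uniq b hb d hd hgbd i z' hz' z hz (by omega) (by omega) (by omega)
        (by omega))
    obtain ⟨a, ha, -⟩ := other (Sum.inl 0) 0
    obtain ⟨b, hb, hab⟩ := other (Sum.inl 0) a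
    obtain ⟨c, hc, -⟩ := other (Sum.inl 1) 0
    obtain ⟨d, hd, hcd⟩ := other (Sum.inl 1) c
    have two : ∀ a ∈ L (Sum.inl 0), ∀ b ∈ L (Sum.inl 0), a ≠ b → ¬ good a c → ¬ good a d →
        False := by
      intro a ha b hb hab h1 h2
      exact hcd.symm (pair_uniq b hb c hc b hb d hd
        (three a ha b hb c hc d hd hab hcd.symm h1 h2)
        (three a ha b hb d hd c hc hab hcd h2 h1)).2
    by_cases h : good a c ∨ good a d
    · refine two b hb a ha hab (fun h' => ?_) fun h' => ?_
      all_goals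
        rcases h with h | h
        · exact hab (pair_uniq _ hb _ ‹_› _ ha _ ‹_› h' h).1
        · exact hab (pair_uniq _ hb _ ‹_› _ ha _ ‹_› h' h).1
    · push Not at h
      exact two a ha b hb hab.symm h.1 h.2

theorem not_rigid_of_card_eq_one {s : Finset V} (hcard : s.card = 1) : ¬ Rigid G s := by
  obtain ⟨v, rfl⟩ := Finset.card_eq_one.1 hcard
  rintro ⟨L, hL, huniq⟩
  obtain ⟨a, b, hab, hLab⟩ := Finset.card_eq_two.1 (hL v)
  have key : ∀ x ∈ L v, IsListColoringOn G L ({v} : Finset V) fun _ => x := by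
    intro x hx
    refine ⟨fun u hu => ?_, fun u hu w hw h => ?_⟩
    · rwa [Finset.mem_singleton.1 hu]
    · rw [Finset.mem_singleton.1 hu, Finset.mem_singleton.1 hw] at h
      exact (h.ne rfl).elim
  exact hab (huniq _ _ (key a (by simp [hLab])) (key b (by simp [hLab]))
    (Finset.mem_singleton_self v))

theorem DelStep.exists_pendant [Fintype V] {s t : Finset V} (h : DelStep G s t) :
    ∃ v w, v ∉ t ∧ (s : Set V) = insert v (t : Set V) ∧ w ∈ t ∧ G.Adj v w ∧
      ∀ u ∈ t, G.Adj v u → u = w := by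
  classical
  obtain ⟨v, hv, hcard, rfl⟩ := h
  obtain ⟨w, hw⟩ := Finset.card_eq_one.1 hcard
  have hmem : ∀ u, (u ∈ s ∧ G.Adj v u) ↔ u = w := fun u => by
    rw [← Finset.mem_singleton, ← hw, Finset.mem_filter]
  obtain ⟨hws, hvw⟩ := (hmem w).2 rfl
  refine ⟨v, w, by simp, ?_, by simp [hws, hvw.ne'], hvw, fun u hu h =>
    (hmem u).1 ⟨Finset.mem_of_mem_erase (by convert hu), h⟩⟩
  ext u
  by_cases h : u = v
  · simp [h, hv]
  · simp [h]

/-- List colorings extend over the deleted vertices of degree one. -/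
theorem DelStep.exists_extension [Fintype V] {s t : Finset V} (h : DelStep G s t)
    {L : V → Finset ℕ} (hL : ∀ v, (L v).card = 2) {φ : V → ℕ} (hφ : IsListColoringOn G L t φ) :
    ∃ ψ, IsListColoringOn G L s ψ ∧ Set.EqOn ψ φ t := by
  classical
  obtain ⟨v, w, hv, hs, hw, hvw, huniq⟩ := h.exists_pendant
  obtain ⟨y, hy, hyw⟩ := (L v).exists_mem_ne (by rw [hL]; norm_num) (φ w)
  have heq : ∀ u ∈ t, Function.update φ v y u = φ u := fun u hu =>
    Function.update_of_ne (ne_of_mem_of_not_mem hu hv) _ _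
  have hvy : ∀ u ∈ t, G.Adj v u → y ≠ φ u := fun u hu h => by rwa [huniq u hu h]
  refine ⟨Function.update φ v y, ?_, heq⟩
  rw [hs]
  constructor
  · rintro u (rfl | hu)
    · rwa [Function.update_self]
    · rw [heq u hu]
      exact hφ.mem u hu
  · rintro u (rfl | hu) u' (rfl | hu') h
    · exact (h.ne rfl).elim
    · rw [Function.update_self, heq u' hu']
      exact hvy u' hu' h
    · rw [Function.update_self, heq u hu]
      exact (hvy u hu h.symm).symm
    · rw [heq u hu, heq u' hu']
      exact hφ.ne u hu u' hu' h

theorem DelStep.rigid [Fintype V] {s t : Finset V} (h : DelStep G s t) (hs : Rigid G s) :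
    Rigid G t := by
  obtain ⟨L, hL, huniq⟩ := hs
  refine ⟨L, hL, fun φ ψ hφ hψ v hv => ?_⟩
  obtain ⟨φ', hφ', hφφ⟩ := h.exists_extension hL hφ
  obtain ⟨ψ', hψ', hψψ⟩ := h.exists_extension hL hψ
  obtain ⟨u, w, -, hst, -⟩ := h.exists_pendant
  rw [← hφφ hv, ← hψψ hv]
  exact huniq φ' ψ' hφ' hψ' (hst ▸ Set.mem_insert_of_mem u hv)

theorem DelStep.preconnected [Fintype V] {s t : Finset V} (h : DelStep G s t)
    (hs : (G.induce (s : Set V)).Preconnected) : (G.induce (t : Set V)).Preconnected := by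
  classical
  obtain ⟨v, w, hv, hst, hw, hvw, huniq⟩ := h.exists_pendant
  rw [induce_preconnected_iff_forall] at hs ⊢
  intro A hA a ha b hb hAa
  have hne : ∀ u ∈ (t : Set V), u ≠ v := fun u hu => ne_of_mem_of_not_mem hu hv
  have := hs (fun u => if u = v then A w else A u) ?_ a (hst ▸ Set.mem_insert_of_mem v ha) b
    (hst ▸ Set.mem_insert_of_mem v hb) (by simpa [hne a ha] using hAa)
  · simpa [hne b hb] using this
  · rw [hst]
    rintro x (rfl | hx) y (rfl | hy) hxy
    · exact id
    · simp [huniq y hy hxy]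
    · simp [huniq x hx hxy.symm]
    · simpa [hne x hx, hne y hy] using hA x hx y hy hxy

variable [Fintype V] {s : Finset V}

theorem IsCore.connected (hs : IsCore G s) (hG : G.Connected) :
    (G.induce (s : Set V)).Connected := by
  have hne := hG.nonempty
  have key : (s : Set V).Nonempty ∧ (G.induce (s : Set V)).Preconnected := by
    obtain ⟨h, -⟩ := hs
    induction h with
    | refl =>
      refine ⟨by simp, ?_⟩
      rw [Finset.coe_univ]
      exact (induceUnivIso G).symm.connected_iff.1 hG |>.preconnected
    | tail _ h ih =>
      obtain ⟨v, w, -, -, hw, -⟩ := h.exists_pendant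
      exact ⟨⟨w, hw⟩, h.preconnected ih.2⟩
  have := key.1.to_subtype
  exact ⟨key.2⟩

theorem IsCore.rigid_iff (hs : IsCore G s) (hG : G.Connected) :
    Rigid G s ↔ Rigid G Set.univ := by
  constructor
  · intro h
    obtain ⟨v⟩ := (hs.connected hG).nonempty
    exact h.univ hG ⟨v, v.2⟩
  · intro h
    obtain ⟨hdel, -⟩ := hs
    induction hdel with
    | refl => rwa [Finset.coe_univ]
    | tail _ h' ih => exact h'.rigid ih

theorem IsCore.exists_isTwoColoring (hs : IsCore G s) {c : V → ℕ}
    (hc : IsListColoringOn G (fun _ => Finset.Icc 1 2) s c) : ∃ c, IsTwoColoring G c := by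
  have key : ∀ t, Relation.ReflTransGen (DelStep G) Finset.univ t → ∀ c,
      IsListColoringOn G (fun _ => Finset.Icc 1 2) t c → ∃ c, IsTwoColoring G c := by
    intro t ht
    induction ht with
    | refl => intro c hc; exact ⟨c, by rwa [Finset.coe_univ] at hc⟩
    | tail _ h ih =>
      intro c hc
      obtain ⟨ψ, hψ, -⟩ := h.exists_extension (fun _ => rfl) hc
      exact ih ψ hψ
  exact key s hs.1 c hc

theorem one_lt_colCount_iff {L : V → Finset ℕ} :
    1 < colCount G L ↔ ∃ φ ψ, IsListColoringOn G L Set.univ φ ∧ IsListColoringOn G L Set.univ ψ ∧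
      φ ≠ ψ := by
  classical
  have hmem : ∀ φ, IsListColoringOn G L Set.univ φ ↔
      (∀ v, φ v ∈ L v) ∧ ∀ v w, G.Adj v w → φ v ≠ φ w := fun φ =>
    ⟨fun h => ⟨fun v => h.mem v trivial, fun v w => h.ne v trivial w trivial⟩,
      fun h => ⟨fun v _ => h.1 v, fun v _ w _ => h.2 v w⟩⟩
  rw [colCount, Finset.one_lt_card]
  simp only [Finset.mem_filter, Fintype.mem_piFinset, hmem]
  exact ⟨fun ⟨φ, h1, ψ, h2, h3⟩ => ⟨φ, ψ, h1, h2, h3⟩, fun ⟨φ, ψ, h1, h2, h3⟩ => ⟨φ, h1, ψ, h2, h3⟩⟩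

theorem colCount_two_le (hG : G.Connected) {c : V → ℕ} (hc : IsTwoColoring G c) :
    colCount G (fun _ => Finset.Icc 1 2) ≤ 2 := by
  classical
  refine (Finset.card_le_card (t := {c, fun v => 3 - c v}) fun φ hφ => ?_).trans Finset.card_le_two
  simp only [Finset.mem_filter, Fintype.mem_piFinset] at hφ
  have hpre : (G.induce (Set.univ : Set V)).Preconnected :=
    ((induceUnivIso G).symm.connected_iff.1 hG).preconnected
  rw [Finset.mem_insert, Finset.mem_singleton]
  exact (eqOn_or_eqOn_of_preconnected hpre hc
    ⟨fun v _ => hφ.1 v, fun v _ w _ => hφ.2 v w⟩).imp (fun h => funext fun v => h v trivial)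
      fun h => funext fun v => h v trivial

theorem monophilic_two_iff_not_rigid (hG : G.Connected) {c : V → ℕ} (hc : IsTwoColoring G c) :
    Monophilic G 2 ↔ ¬ Rigid G Set.univ := by
  constructor
  · rintro hmono ⟨L, hL, huniq⟩
    have h2 : 1 < colCount G fun _ => Finset.Icc 1 2 := by
      refine one_lt_colCount_iff.2 ⟨c, fun v => 3 - c v, hc, ⟨fun v _ => ?_, fun v _ w _ h => ?_⟩,
        fun h => ?_⟩
      · have := hc.bounds v
        rw [Finset.mem_Icc]
        omega
      · have := hc.adj_ne h
        have := hc.bounds v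
        have := hc.bounds w
        omega
      · obtain ⟨v⟩ := hG.nonempty
        have := hc.bounds v
        have : c v = 3 - c v := congrFun h v
        omega
    obtain ⟨φ, ψ, hφ, hψ, hne⟩ := one_lt_colCount_iff.1 (h2.trans_le (hmono L hL))
    exact hne (funext fun v => huniq φ ψ hφ hψ (Set.mem_univ v))
  · intro hrigid L hL
    refine (colCount_two_le hG hc).trans (one_lt_colCount_iff.2 ?_)
    by_contra! h
    exact hrigid ⟨L, hL, fun φ ψ hφ hψ v _ => congrFun (h φ ψ hφ hψ) v⟩

theorem monophilic_two_of_forall_not_isTwoColoring (h : ∀ c, ¬ IsTwoColoring G c) :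
    Monophilic G 2 := by
  classical
  intro L _
  refine le_of_eq_of_le (Finset.card_eq_zero.2 (Finset.eq_empty_of_forall_notMem fun c hc => ?_))
    (Nat.zero_le _)
  simp only [Finset.mem_filter, Fintype.mem_piFinset] at hc
  exact h c ⟨fun v _ => hc.1 v, fun v _ w _ => hc.2 v w⟩

theorem length_mod_two_eq_bypass [DecidableEq W]
    (h : ∀ (x : W) (c : H.Walk x x), c.IsCycle → ¬ Odd c.length) {u v : W} (p : H.Walk u v) :
    p.length % 2 = p.bypass.length % 2 := by
  induction p with
  | nil => rfl
  | @cons u w v huw p ih =>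
    rw [Walk.bypass, Walk.length_cons]
    split_ifs with hs
    · have hq := (p.bypass_isPath).takeUntil hs
      have hlen : (p.bypass.takeUntil u hs).length + (p.bypass.dropUntil u hs).length =
          p.bypass.length := by
        rw [← Walk.length_append, Walk.take_spec]
      have hodd : Odd (p.bypass.takeUntil u hs).length := by
        by_cases hedge : s(u, w) ∈ (p.bypass.takeUntil u hs).edges
        · rw [Sym2.eq_swap] at hedge
          rw [hq.length_eq_one_of_mem_edges hedge]
          exact odd_one
        · have := h u _ ((Walk.cons_isCycle_iff _ huw).2 ⟨hq, hedge⟩)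
          rw [Walk.length_cons, Nat.not_odd_iff_even, Nat.even_add_one] at this
          exact Nat.not_even_iff_odd.1 this
      obtain ⟨k, hk⟩ := hodd
      omega
    · rw [Walk.length_cons]
      omega

theorem colorable_two_of_forall_not_odd_cycle
    (h : ∀ (x : W) (c : H.Walk x x), c.IsCycle → ¬ Odd c.length) : H.Colorable 2 := by
  classical
  refine two_colorable_iff_forall_loop_even.2 fun u w => ?_
  have h1 := length_mod_two_eq_bypass h w
  rw [Walk.length_eq_zero_iff.2 (Walk.isPath_iff_nil.1 w.bypass_isPath)] at h1
  exact Nat.even_iff.2 h1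

theorem IsTwoColoring.colorable {c : W → ℕ} (hc : IsTwoColoring H c) : H.Colorable 2 :=
  ⟨Coloring.mk (fun v => (⟨c v - 1, by have := hc.bounds v; omega⟩ : Fin 2)) fun {v w} h heq => by
    have := hc.adj_ne h
    have := hc.bounds v
    have := hc.bounds w
    have := Fin.mk.inj heq
    omega⟩

theorem exists_isListColoringOn_of_colorable {S : Set W} (h : (H.induce S).Colorable 2) :
    ∃ c, IsListColoringOn H (fun _ => Finset.Icc 1 2) S c := by
  classical
  obtain ⟨f⟩ := h
  refine ⟨fun v => if hv : v ∈ S then (f ⟨v, hv⟩).val + 1 else 1, fun v hv => ?_,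
    fun v hv w hw hvw heq => ?_⟩
  · rw [dif_pos hv, Finset.mem_Icc]
    omega
  · rw [dif_pos hv, dif_pos hw, Nat.add_right_cancel_iff] at heq
    exact f.valid (v := ⟨v, hv⟩) (w := ⟨w, hw⟩) hvw (Fin.ext heq)

theorem IsCore.exists_adj_ne (hs : IsCore G s) (hG : G.Connected) (hcard : s.card ≠ 1)
    (v w : (s : Set V)) : ∃ u, u ≠ w ∧ (G.induce (s : Set V)).Adj v u := by
  classical
  have hnontriv : Nontrivial (s : Set V) := by
    have : 0 < s.card := Finset.card_pos.2 ⟨v, v.2⟩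
    exact Set.nontrivial_coe_sort.2 (Finset.one_lt_card_iff_nontrivial.1 (by omega))
  obtain ⟨u, hu⟩ := (hs.connected hG).preconnected.exists_adj_of_nontrivial v
  have hmem : u.val ∈ s.filter fun w => G.Adj v w := Finset.mem_filter.2 ⟨u.2, hu⟩
  have hne : (s.filter fun w => G.Adj v w).card ≠ 1 := by
    convert hs.2 v v.2
  have := Finset.card_pos.2 ⟨_, hmem⟩
  obtain ⟨u', hu', hne'⟩ := (s.filter fun w => G.Adj v w).exists_mem_ne (by omega) w
  rw [Finset.mem_filter] at hu'
  exact ⟨⟨u', hu'.1⟩, fun h => hne' (congrArg Subtype.val h), hu'.2⟩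

theorem even_of_colorable_cycleGraph {m : ℕ} (hm : 3 ≤ m) (h : (cycleGraph m).Colorable 2) :
    Even m := by
  by_contra hodd
  have h1 := chromaticNumber_cycleGraph_of_odd m (by omega) (Nat.not_even_iff_odd.1 hodd)
  have h2 := h.chromaticNumber_le
  rw [h1] at h2
  norm_cast at h2

end

theorem stmt14 {V : Type*} [Fintype V] (G : SimpleGraph V) (hconn : G.Connected)
    (s : Finset V) (hs : IsCore G s) :
    Monophilic G 2 ↔
      (s.card = 1 ∨
        (∃ m, 3 ≤ m ∧ Nonempty (G.induce (↑s : Set V) ≃g cycleGraph m)) ∨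
        Nonempty (G.induce (↑s : Set V) ≃g completeBipartiteGraph (Fin 2) (Fin 3)) ∨
        ∃ (x : (↑s : Set V)) (c : (G.induce (↑s : Set V)).Walk x x), c.IsCycle ∧ Odd c.length) := by
  have hrigid := hs.rigid_iff hconn
  rw [← rigid_induce_iff] at hrigid
  constructor
  · intro hmono
    by_contra! hcon
    obtain ⟨hcard, hcycle, hK, hodd⟩ := hcon
    have hcol := colorable_two_of_forall_not_odd_cycle fun x c hc h => hodd x c hc h
    obtain ⟨c, hc⟩ := exists_isListColoringOn_of_colorable hcol
    obtain ⟨c', hc'⟩ := hs.exists_isTwoColoring hc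
    have hnot := mt hrigid.1 ((monophilic_two_iff_not_rigid hconn hc').1 hmono)
    have hind : IsTwoColoring (G.induce (s : Set V)) fun v => c v :=
      ⟨fun v _ => hc.mem v v.2, fun v _ w _ h => hc.ne v v.2 w w.2 h⟩
    rcases rigid_or_cycle_or_completeBipartite (hs.connected hconn) hind
      (hs.exists_adj_ne hconn hcard) with h | ⟨m, hm, h⟩ | h
    · exact hnot h
    · exact (hcycle m hm).false h.some
    · exact hK.false h.some
  · intro h
    by_cases hcol : ∃ c, IsTwoColoring G c
    · obtain ⟨c, hc⟩ := hcol
      have hind : (G.induce (s : Set V)).Colorable 2 :=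
        hc.colorable.of_hom (Embedding.induce (s : Set V)).toHom
      rw [monophilic_two_iff_not_rigid hconn hc, ← hrigid]
      rcases h with h | ⟨m, hm, ⟨e⟩⟩ | ⟨⟨e⟩⟩ | ⟨x, p, -, hp⟩
      · rw [rigid_induce_iff]
        exact not_rigid_of_card_eq_one h
      · rw [rigid_univ_congr e.symm]
        exact not_rigid_cycleGraph hm
          (even_of_colorable_cycleGraph hm (hind.of_hom e.symm.toEmbedding.toHom))
      · rw [rigid_univ_congr e.symm]
        exact not_rigid_completeBipartiteGraph
      · exact (Nat.not_even_iff_odd.2 hp (two_colorable_iff_forall_loop_even.1 hind x p)).elim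
    · push Not at hcol
      exact monophilic_two_of_forall_not_isTwoColoring hcol
end

section
/- For n ≥ 3, if L is a minimizing (n,n−1)-list assignment for a path P of length k ≥ 2, then L is type A when k is odd and type B when k is even; consequently min over all (n,n−1)-list assignments of col(P,L) equals A_k when k is odd and B_k = A_k − (−1)^k when k is even. -/
open SimpleGraph

/-- A type A `(n,n-1)`-list assignment for the path with `k+1` vertices: all interior
vertices share a common `n`-list `T`, and both terminal vertices get the same
`(n-1)`-subset `S` of `T`. -/
def IsTypeA (n k : ℕ) (L : Fin (k + 1) → Finset ℕ) : Prop :=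
  ∃ S T : Finset ℕ, S.card = n - 1 ∧ T.card = n ∧ S ⊆ T ∧
    L 0 = S ∧ L (Fin.last k) = S ∧
    ∀ i : Fin (k + 1), i ≠ 0 → i ≠ Fin.last k → L i = T

/-- A type B `(n,n-1)`-list assignment: as in type A, but the two terminal
`(n-1)`-lists are distinct subsets of the common interior `n`-list. -/
def IsTypeB (n k : ℕ) (L : Fin (k + 1) → Finset ℕ) : Prop :=
  ∃ S₁ S₂ T : Finset ℕ, S₁.card = n - 1 ∧ S₂.card = n - 1 ∧ T.card = n ∧
    S₁ ⊆ T ∧ S₂ ⊆ T ∧ S₁ ≠ S₂ ∧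
    L 0 = S₁ ∧ L (Fin.last k) = S₂ ∧
    ∀ i : Fin (k + 1), i ≠ 0 → i ≠ Fin.last k → L i = T

/-- `L` is a minimizing list assignment for `G`: it minimizes the number of list
colorings among all list assignments with the same list sizes. -/
def Minimizing {V : Type*} [Fintype V] (G : SimpleGraph V) (L : V → Finset ℕ) : Prop :=
  ∀ L' : V → Finset ℕ, (∀ v, (L' v).card = (L v).card) → colCount G L ≤ colCount G L'

/-- A coloring of a path is proper iff it separates consecutive vertices. -/
theorem isProper_path_iff {k : ℕ} {γ : Fin (k + 1) → ℕ} :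
    (∀ v w, (pathGraph (k + 1)).Adj v w → γ v ≠ γ w) ↔
      ∀ i : Fin k, γ i.castSucc ≠ γ i.succ := by
  refine ⟨fun h i => h _ _ ?_, fun h v w hvw => ?_⟩
  · simp [pathGraph_adj]
  · rw [pathGraph_adj] at hvw
    rcases hvw with hvw | hvw
    · have := h ⟨v, by omega⟩
      rwa [show Fin.castSucc ⟨v, by omega⟩ = v from rfl,
        show Fin.succ ⟨v, by omega⟩ = w from Fin.ext hvw] at this
    · have := h ⟨w, by omega⟩
      rw [show Fin.castSucc ⟨w, by omega⟩ = w from rfl,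
        show Fin.succ ⟨w, by omega⟩ = v from Fin.ext hvw] at this
      exact this.symm

/-- Remove the color `c` from the list of the initial vertex. -/
def eraseHead {k : ℕ} (c : ℕ) (M : Fin (k + 1) → Finset ℕ) : Fin (k + 1) → Finset ℕ :=
  Function.update M 0 ((M 0).erase c)

@[simp] theorem eraseHead_zero {k : ℕ} (c : ℕ) (M : Fin (k + 1) → Finset ℕ) :
    eraseHead c M 0 = (M 0).erase c := by
  simp [eraseHead]

theorem eraseHead_of_ne {k : ℕ} (c : ℕ) (M : Fin (k + 1) → Finset ℕ) {i : Fin (k + 1)}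
    (hi : i ≠ 0) : eraseHead c M i = M i := by
  simp [eraseHead, hi]

theorem mem_eraseHead {k : ℕ} {c x : ℕ} {M : Fin (k + 1) → Finset ℕ} {i : Fin (k + 1)} :
    x ∈ eraseHead c M i ↔ x ∈ M i ∧ (i = 0 → x ≠ c) := by
  rcases eq_or_ne i 0 with rfl | hi
  · simp [and_comm]
  · simp [eraseHead_of_ne, hi]

theorem colCount_path_zero (L : Fin 1 → Finset ℕ) :
    colCount (pathGraph 1) L = (L 0).card := by
  classical
  refine Finset.card_nbij' (fun γ => γ 0) (fun c _ => c) ?_ ?_ ?_ ?_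
  · intro γ hγ
    simp only [Finset.coe_filter, Fintype.mem_piFinset, Set.mem_ofPred_eq] at hγ
    exact hγ.1 0
  · intro c hc
    simpa [isProper_path_iff] using hc
  · intro γ _
    ext i
    simp [Subsingleton.elim i 0]
  · intro c _
    rfl

theorem colCount_path_succ {k : ℕ} (L : Fin (k + 2) → Finset ℕ) :
    colCount (pathGraph (k + 2)) L =
      ∑ c ∈ L 0, colCount (pathGraph (k + 1)) (eraseHead c (Fin.tail L)) := by
  classical
  unfold colCount
  rw [← Finset.card_sigma]
  refine Finset.card_nbij' (fun γ => ⟨γ 0, Fin.tail γ⟩) (fun p => Fin.cons p.1 p.2) ?_ ?_ ?_ ?_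
  · intro γ hγ
    simp only [Finset.coe_filter, Fintype.mem_piFinset, Set.mem_ofPred_eq,
      isProper_path_iff] at hγ
    simp only [Finset.coe_sigma, Set.mem_sigma_iff, Finset.mem_coe, Finset.mem_filter,
      Fintype.mem_piFinset, isProper_path_iff, mem_eraseHead, Fin.tail]
    refine ⟨hγ.1 0, fun v => ⟨hγ.1 _, ?_⟩, fun i => hγ.2 i.succ⟩
    rintro rfl
    exact (hγ.2 0).symm
  · rintro ⟨c, δ⟩ h
    simp only [Finset.coe_sigma, Set.mem_sigma_iff, Finset.mem_coe, Finset.mem_filter,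
      Fintype.mem_piFinset, isProper_path_iff, mem_eraseHead, Fin.tail] at h
    simp only [Finset.coe_filter, Fintype.mem_piFinset, Set.mem_ofPred_eq,
      isProper_path_iff]
    refine ⟨fun v => ?_, fun i => ?_⟩
    · cases v using Fin.cases with
      | zero => exact h.1
      | succ v => exact (h.2.1 v).1
    · cases i using Fin.cases with
      | zero => exact ((h.2.1 0).2 rfl).symm
      | succ i => exact h.2.2 i
  · intro γ _
    simp
  · rintro ⟨c, δ⟩ _
    simp

theorem colCount_path_comp_rev {k : ℕ} (L : Fin (k + 1) → Finset ℕ) :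
    colCount (pathGraph (k + 1)) (L ∘ Fin.rev) = colCount (pathGraph (k + 1)) L := by
  classical
  refine Finset.card_nbij' (fun γ => γ ∘ Fin.rev) (fun γ => γ ∘ Fin.rev) ?_ ?_ ?_ ?_
  · intro γ hγ
    simp only [Finset.coe_filter, Fintype.mem_piFinset, Set.mem_ofPred_eq] at hγ ⊢
    refine ⟨fun v => by simpa using hγ.1 v.rev, fun v w h => hγ.2 _ _ ?_⟩
    rw [pathGraph_adj] at h ⊢
    simp only [Fin.val_rev]
    omega
  · intro γ hγ
    simp only [Finset.coe_filter, Fintype.mem_piFinset, Set.mem_ofPred_eq] at hγ ⊢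
    refine ⟨fun v => hγ.1 v.rev, fun v w h => hγ.2 _ _ ?_⟩
    rw [pathGraph_adj] at h ⊢
    simp only [Fin.val_rev]
    omega
  · intro γ _
    ext; simp
  · intro γ _
    ext; simp

theorem colCount_path_pos {k : ℕ} (L : Fin (k + 1) → Finset ℕ) (h0 : 0 < (L 0).card)
    (h : ∀ i, i ≠ 0 → 2 ≤ (L i).card) : 0 < colCount (pathGraph (k + 1)) L := by
  induction k with
  | zero => rwa [colCount_path_zero]
  | succ k ih =>
    rw [colCount_path_succ]
    refine Finset.sum_pos (fun c _ => ih _ ?_ fun i hi => ?_) (Finset.card_pos.1 h0)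
    · have h1 := h (Fin.succ 0) (Fin.succ_ne_zero _)
      have h2 := Finset.pred_card_le_card_erase (s := L (Fin.succ 0)) (a := c)
      rw [eraseHead_zero, Fin.tail]
      omega
    · rw [eraseHead_of_ne _ _ hi]
      exact h _ (Fin.succ_ne_zero _)

theorem colCount_eraseHead_lt {k : ℕ} (M : Fin (k + 1) → Finset ℕ)
    (h : ∀ i, i ≠ 0 → 2 ≤ (M i).card) {x : ℕ} (hx : x ∈ M 0) :
    colCount (pathGraph (k + 1)) (eraseHead x M) < colCount (pathGraph (k + 1)) M := by
  cases k with
  | zero =>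
    rw [colCount_path_zero, colCount_path_zero, eraseHead_zero]
    exact Finset.card_erase_lt_of_mem hx
  | succ k =>
    have ht : Fin.tail (eraseHead x M) = Fin.tail M :=
      funext fun i => eraseHead_of_ne _ _ (Fin.succ_ne_zero i)
    rw [colCount_path_succ, colCount_path_succ, eraseHead_zero, ht,
      ← Finset.add_sum_erase _ _ hx]
    refine Nat.lt_add_of_pos_left (colCount_path_pos _ ?_ fun i hi => ?_)
    · have h1 := h (Fin.succ 0) (Fin.succ_ne_zero _)
      have h2 := Finset.pred_card_le_card_erase (s := M (Fin.succ 0)) (a := x)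
      rw [eraseHead_zero, Fin.tail]
      omega
    · rw [eraseHead_of_ne _ _ hi]
      exact h _ (Fin.succ_ne_zero _)

/-- The numbers of colorings of type A and type B assignments on a path of length `k`. -/
def typeCounts (n : ℕ) : ℕ → ℕ × ℕ
  | 0 => (n - 1, n - 2)
  | k + 1 => ((n - 1) * (typeCounts n k).2,
      (typeCounts n k).1 + (n - 2) * (typeCounts n k).2)

theorem typeCounts_parity {n : ℕ} (hn : 3 ≤ n) (k : ℕ) :
    (Even k → (typeCounts n k).1 = (typeCounts n k).2 + 1) ∧
    (Odd k → (typeCounts n k).2 = (typeCounts n k).1 + 1) := by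
  obtain ⟨m, rfl⟩ : ∃ m, n = m + 2 := ⟨n - 2, by omega⟩
  induction k with
  | zero => simp [typeCounts]
  | succ k ih =>
    simp only [typeCounts, Nat.add_sub_cancel, show m + 2 - 1 = m + 1 by omega]
    refine ⟨fun h => ?_, fun h => ?_⟩
    · have := ih.2 (by simpa [Nat.even_add_one] using h)
      rw [this]; ring
    · have := ih.1 (by simpa [Nat.odd_add_one] using h)
      rw [this]; ring

/-- All interior lists are `T`, and the endpoint lists are `T` without `d₁` and `d₂`. -/
def endErasedLists (k : ℕ) (T : Finset ℕ) (d₁ d₂ : ℕ) (i : Fin (k + 1)) : Finset ℕ :=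
  if i = 0 then T.erase d₁ else if i = Fin.last k then T.erase d₂ else T

theorem eraseHead_tail_endErasedLists {k : ℕ} (hk : k ≠ 0) (T : Finset ℕ) (c d₁ d₂ : ℕ) :
    eraseHead c (Fin.tail (endErasedLists (k + 1) T d₁ d₂)) = endErasedLists k T c d₂ := by
  funext i
  rcases eq_or_ne i 0 with rfl | hi
  · have : (Fin.succ 0 : Fin (k + 2)) ≠ Fin.last (k + 1) := by
      rw [Ne, Fin.ext_iff]; simpa using hk
    simp only [eraseHead_zero, Fin.tail, endErasedLists, if_neg (Fin.succ_ne_zero _), if_neg this,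
      if_true]
  · rw [eraseHead_of_ne _ _ hi]
    simp only [Fin.tail, endErasedLists, if_neg (Fin.succ_ne_zero _), if_neg hi, ← Fin.succ_last,
      Fin.succ_inj]

theorem colCount_endErasedLists {n k : ℕ} (hk : k ≠ 0) {T : Finset ℕ} (hT : T.card = n)
    {d₁ d₂ : ℕ} (h₁ : d₁ ∈ T) (h₂ : d₂ ∈ T) :
    colCount (pathGraph (k + 1)) (endErasedLists k T d₁ d₂) =
      if d₁ = d₂ then (typeCounts n k).1 else (typeCounts n k).2 := by
  induction k generalizing d₁ with
  | zero => exact absurd rfl hk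
  | succ k ih =>
    have key : ∀ c ∈ T.erase d₁, colCount (pathGraph (k + 1))
        (eraseHead c (Fin.tail (endErasedLists (k + 1) T d₁ d₂))) =
          if c = d₂ then (typeCounts n k).1 else (typeCounts n k).2 := by
      intro c hc
      have hcT := Finset.mem_of_mem_erase hc
      rcases eq_or_ne k 0 with rfl | hk0
      · rw [colCount_path_zero, eraseHead_zero]
        have : Fin.tail (endErasedLists (0 + 1) T d₁ d₂) 0 = T.erase d₂ := by
          simp [Fin.tail, endErasedLists]
        rw [this]
        split_ifs with h
        · subst h
          simp [typeCounts, Finset.card_erase_of_mem, hcT, hT]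
        · rw [Finset.card_erase_of_mem (Finset.mem_erase.2 ⟨h, hcT⟩),
            Finset.card_erase_of_mem h₂, hT]
          simp [typeCounts]
          omega
      · rw [eraseHead_tail_endErasedLists hk0, ih hk0 hcT]
    rw [colCount_path_succ, show endErasedLists (k + 1) T d₁ d₂ 0 = T.erase d₁ by
      simp [endErasedLists], Finset.sum_congr rfl key]
    by_cases h : d₁ = d₂
    · subst h
      rw [if_pos rfl, Finset.sum_congr rfl fun c hc => if_neg (Finset.ne_of_mem_erase hc)]
      simp [typeCounts, Finset.card_erase_of_mem, h₁, hT]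
    · have hd : d₂ ∈ T.erase d₁ := Finset.mem_erase.2 ⟨Ne.symm h, h₂⟩
      rw [if_neg h, ← Finset.add_sum_erase _ _ hd, if_pos rfl,
        Finset.sum_congr rfl fun c hc => if_neg (Finset.ne_of_mem_erase hc)]
      simp [typeCounts, Finset.card_erase_of_mem, hd, h₁, hT, Nat.sub_sub]

theorem exists_eq_erase_of_card {n : ℕ} (hn : n ≠ 0) {S T : Finset ℕ} (hST : S ⊆ T)
    (hS : S.card = n - 1) (hT : T.card = n) : ∃ d ∈ T, S = T.erase d := by
  obtain ⟨d, hdT, hdS⟩ := Finset.exists_mem_notMem_of_card_lt_card (s := S) (t := T) (by omega)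
  refine ⟨d, hdT, Finset.eq_of_subset_of_card_le (Finset.subset_erase.2 ⟨hST, hdS⟩) ?_⟩
  rw [Finset.card_erase_of_mem hdT]
  omega

theorem eq_endErasedLists {k : ℕ} {L : Fin (k + 1) → Finset ℕ} {T : Finset ℕ} {d₁ d₂ : ℕ}
    (h0 : L 0 = T.erase d₁) (hlast : L (Fin.last k) = T.erase d₂)
    (hint : ∀ i : Fin (k + 1), i ≠ 0 → i ≠ Fin.last k → L i = T) :
    L = endErasedLists k T d₁ d₂ := by
  funext i
  unfold endErasedLists
  split_ifs with h h'
  · rw [h, h0]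
  · rw [h', hlast]
  · exact hint i h h'

theorem IsTypeA.colCount_eq {n k : ℕ} (hn : n ≠ 0) (hk : k ≠ 0) {L : Fin (k + 1) → Finset ℕ}
    (h : IsTypeA n k L) : colCount (pathGraph (k + 1)) L = (typeCounts n k).1 := by
  obtain ⟨S, T, hS, hT, hST, h0, hlast, hint⟩ := h
  obtain ⟨d, hd, rfl⟩ := exists_eq_erase_of_card hn hST hS hT
  rw [eq_endErasedLists h0 hlast hint, colCount_endErasedLists hk hT hd hd, if_pos rfl]

theorem IsTypeB.colCount_eq {n k : ℕ} (hn : n ≠ 0) (hk : k ≠ 0) {L : Fin (k + 1) → Finset ℕ}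
    (h : IsTypeB n k L) : colCount (pathGraph (k + 1)) L = (typeCounts n k).2 := by
  obtain ⟨S₁, S₂, T, hS₁, hS₂, hT, hST₁, hST₂, hne, h0, hlast, hint⟩ := h
  obtain ⟨d₁, hd₁, rfl⟩ := exists_eq_erase_of_card hn hST₁ hS₁ hT
  obtain ⟨d₂, hd₂, rfl⟩ := exists_eq_erase_of_card hn hST₂ hS₂ hT
  rw [eq_endErasedLists h0 hlast hint, colCount_endErasedLists hk hT hd₁ hd₂, if_neg]
  rintro rfl
  exact hne rfl

/-- `L` has lists of size `n` at interior vertices and of size `n - 1` at the endpoints. -/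
structure IsPathListAssignment (n k : ℕ) (L : Fin (k + 1) → Finset ℕ) : Prop where
  zero : (L 0).card = n - 1
  last : (L (Fin.last k)).card = n - 1
  interior : ∀ i : Fin (k + 1), i ≠ 0 → i ≠ Fin.last k → (L i).card = n

namespace IsPathListAssignment

variable {n k : ℕ}

theorem comp_rev {L : Fin (k + 1) → Finset ℕ} (h : IsPathListAssignment n k L) :
    IsPathListAssignment n k (L ∘ Fin.rev) where
  zero := by simpa using h.last
  last := by simpa using h.zero
  interior i hi hi' := h.interior _ (by rwa [Ne, Fin.rev_eq_iff, Fin.rev_zero])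
    (by rwa [Ne, Fin.rev_eq_iff, Fin.rev_last])

theorem card_one {L : Fin (k + 2) → Finset ℕ} (h : IsPathListAssignment n (k + 1) L)
    (hk : k ≠ 0) : (L 1).card = n :=
  h.interior 1 (by simp) (by rw [Ne, Fin.ext_iff]; simpa using hk)

theorem eraseHead_tail {L : Fin (k + 2) → Finset ℕ} (h : IsPathListAssignment n (k + 1) L)
    (hk : k ≠ 0) {c : ℕ} (hc : c ∈ L 1) : IsPathListAssignment n k (eraseHead c (Fin.tail L)) where
  zero := by
    rw [eraseHead_zero, Fin.tail, Fin.succ_zero_eq_one, Finset.card_erase_of_mem hc, h.card_one hk]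
  last := by
    rw [eraseHead_of_ne _ _ (by rw [Ne, Fin.ext_iff]; simpa using hk), Fin.tail, Fin.succ_last]
    exact h.last
  interior i hi hi' := by
    rw [eraseHead_of_ne _ _ hi, Fin.tail]
    exact h.interior _ (Fin.succ_ne_zero i) (by rwa [Ne, ← Fin.succ_last, Fin.succ_inj])

theorem eraseHead_tail_last (hk : k ≠ 0) (L : Fin (k + 2) → Finset ℕ) (c : ℕ) :
    eraseHead c (Fin.tail L) (Fin.last k) = L (Fin.last (k + 1)) := by
  rw [eraseHead_of_ne _ _ (by rw [Ne, Fin.ext_iff]; simpa using hk), Fin.tail, Fin.succ_last]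

/-- A lower bound `m` for shorter paths bounds the number of colorings starting with `c`,
strictly so if `c` is not in the list of the second vertex. -/
theorem le_colCount_eraseHead_tail {L : Fin (k + 2) → Finset ℕ} (hn : 3 ≤ n)
    (h : IsPathListAssignment n (k + 1) L) (hk : k ≠ 0) {m : ℕ}
    (hm : ∀ M, IsPathListAssignment n k M → m ≤ colCount (pathGraph (k + 1)) M) (c : ℕ) :
    m ≤ colCount (pathGraph (k + 1)) (eraseHead c (Fin.tail L)) ∧
      (colCount (pathGraph (k + 1)) (eraseHead c (Fin.tail L)) = m → c ∈ L 1) := by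
  by_cases hc : c ∈ L 1
  · exact ⟨hm _ (h.eraseHead_tail hk hc), fun _ => hc⟩
  · have hM : eraseHead c (Fin.tail L) = Fin.tail L := by
      rw [eraseHead, Finset.erase_eq_of_notMem (by simpa [Fin.tail] using hc),
        Function.update_eq_self]
    obtain ⟨x, hx⟩ : (L 1).Nonempty := by
      rw [← Finset.card_pos, h.card_one hk]; omega
    have hlt : colCount (pathGraph (k + 1)) (eraseHead x (Fin.tail L)) <
        colCount (pathGraph (k + 1)) (Fin.tail L) := by
      refine colCount_eraseHead_lt _ (fun i _ => ?_) (by simpa [Fin.tail] using hx)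
      by_cases hi : i.succ = Fin.last (k + 1)
      · rw [Fin.tail, hi, h.last]; omega
      · rw [Fin.tail, h.interior _ (Fin.succ_ne_zero i) hi]; omega
    have := hm _ (h.eraseHead_tail hk hx)
    rw [hM]
    exact ⟨by omega, fun _ => by omega⟩

theorem typeCounts_one_le_colCount {L : Fin 2 → Finset ℕ} (hn : 3 ≤ n)
    (h : IsPathListAssignment n 1 L) :
    (typeCounts n 1).1 ≤ colCount (pathGraph 2) L ∧
      (colCount (pathGraph 2) L = (typeCounts n 1).1 → IsTypeA n 1 L) := by
  have h0 : (L 0).card = n - 1 := h.zero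
  have h1 : (L 1).card = n - 1 := h.last
  have hle : ∀ c ∈ L 0, n - 2 ≤ ((L 1).erase c).card := fun c _ => by
    have := Finset.pred_card_le_card_erase (s := L 1) (a := c)
    omega
  have hsum : colCount (pathGraph 2) L = ∑ c ∈ L 0, ((L 1).erase c).card := by
    rw [colCount_path_succ]
    exact Finset.sum_congr rfl fun c _ => by rw [colCount_path_zero, eraseHead_zero]; rfl
  have hA : (typeCounts n 1).1 = ∑ c ∈ L 0, (n - 2) := by
    simp [typeCounts, h0]
  rw [hsum, hA]
  refine ⟨Finset.sum_le_sum hle, fun heq => ?_⟩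
  have heq' := (Finset.sum_eq_sum_iff_of_le hle).1 heq.symm
  have hsub : L 0 ⊆ L 1 := fun c hc => by
    by_contra hc'
    have := heq' c hc
    rw [Finset.erase_eq_of_notMem hc'] at this
    omega
  have h01 : L 0 = L 1 := Finset.eq_of_subset_of_card_le hsub (by omega)
  obtain ⟨x, hx⟩ := Infinite.exists_notMem_finset (L 0)
  refine ⟨L 0, insert x (L 0), h0, ?_, Finset.subset_insert _ _, rfl, h01.symm, ?_⟩
  · rw [Finset.card_insert_of_notMem hx]; omega
  · intro i hi hi'
    fin_cases i
    · exact absurd rfl hi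
    · exact absurd rfl hi'

theorem typeA_step {L : Fin (k + 2) → Finset ℕ} (hn : 3 ≤ n) (hk : k ≠ 0) (hev : Even k)
    (h : IsPathListAssignment n (k + 1) L)
    (ih : ∀ M, IsPathListAssignment n k M →
      (typeCounts n k).2 ≤ colCount (pathGraph (k + 1)) M ∧
        (colCount (pathGraph (k + 1)) M = (typeCounts n k).2 → IsTypeB n k M)) :
    (typeCounts n (k + 1)).1 ≤ colCount (pathGraph (k + 2)) L ∧
      (colCount (pathGraph (k + 2)) L = (typeCounts n (k + 1)).1 → IsTypeA n (k + 1) L) := by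
  have hle := h.le_colCount_eraseHead_tail hn hk fun M hM => (ih M hM).1
  have hA : (typeCounts n (k + 1)).1 = ∑ c ∈ L 0, (typeCounts n k).2 := by
    simp [typeCounts, h.zero]
  rw [colCount_path_succ, hA]
  refine ⟨Finset.sum_le_sum fun c _ => (hle c).1, fun heq => ?_⟩
  have heq' := (Finset.sum_eq_sum_iff_of_le fun c _ => (hle c).1).1 heq.symm
  have hsub : L 0 ⊆ L 1 := fun c hc => (hle c).2 (heq' c hc).symm
  have hk2 : 2 ≤ k := by
    obtain ⟨r, hr⟩ := hev
    omega
  have hB : ∀ c ∈ L 0, (L 1).erase c ⊆ L ⟨2, by omega⟩ ∧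
      L (Fin.last (k + 1)) ⊆ L ⟨2, by omega⟩ ∧ (L 1).erase c ≠ L (Fin.last (k + 1)) ∧
      ∀ i : Fin (k + 1), i ≠ 0 → i ≠ Fin.last k → L i.succ = L ⟨2, by omega⟩ := by
    intro c hc
    obtain ⟨S₁, S₂, T, -, -, -, hST₁, hST₂, hne, hz, hl, hi⟩ :=
      (ih _ (h.eraseHead_tail hk (hsub hc))).2 (heq' c hc).symm
    rw [eraseHead_zero, Fin.tail, Fin.succ_zero_eq_one] at hz
    rw [eraseHead_tail_last hk] at hl
    have hi' : ∀ i : Fin (k + 1), i ≠ 0 → i ≠ Fin.last k → L i.succ = T := fun i h1 h2 => by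
      have := hi i h1 h2
      rwa [eraseHead_of_ne _ _ h1, Fin.tail] at this
    have hT : L ⟨2, by omega⟩ = T := hi' ⟨1, by omega⟩ (by simp [Fin.ext_iff])
      (by simp only [Ne, Fin.ext_iff, Fin.val_last]; omega)
    rw [hz, hl, hT]
    exact ⟨hST₁, hST₂, hne, hi'⟩
  have hcard0 := h.zero
  have hcard1 := h.card_one hk
  have hcard2 : (L ⟨2, by omega⟩).card = n := h.interior _ (by simp [Fin.ext_iff])
    (by simp only [Ne, Fin.ext_iff, Fin.val_last]; omega)
  have h12 : L 1 = L ⟨2, by omega⟩ := by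
    refine Finset.eq_of_subset_of_card_le (fun x hx => ?_) (by omega)
    obtain ⟨c, hc, hcx⟩ := Finset.exists_mem_ne (s := L 0) (by omega) x
    exact (hB c hc).1 (Finset.mem_erase.2 ⟨hcx.symm, hx⟩)
  obtain ⟨c₀, hc₀⟩ : (L 0).Nonempty := by
    rw [← Finset.card_pos]; omega
  obtain ⟨-, hlast, -, hint⟩ := hB c₀ hc₀
  rw [← h12] at hlast hint
  obtain ⟨d, hd, hLd⟩ := exists_eq_erase_of_card (by omega) hlast h.last hcard1
  have hd0 : d ∉ L 0 := fun hd0 => (hB d hd0).2.2.1 hLd.symm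
  have hL0 : L 0 = (L 1).erase d := by
    refine Finset.eq_of_subset_of_card_le (Finset.subset_erase.2 ⟨hsub, hd0⟩) ?_
    rw [Finset.card_erase_of_mem hd]
    omega
  refine ⟨L 0, L 1, h.zero, hcard1, hsub, rfl, hLd.trans hL0.symm, fun i hi hi' => ?_⟩
  obtain ⟨j, rfl⟩ := Fin.exists_succ_eq.2 hi
  rcases eq_or_ne j 0 with rfl | hj
  · rfl
  · exact hint j hj (by rwa [Ne, ← Fin.succ_last, Fin.succ_inj] at hi')

theorem typeB_step_aux {L : Fin (k + 2) → Finset ℕ} (hn : 3 ≤ n) (hk : k ≠ 0) (hodd : Odd k)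
    (h : IsPathListAssignment n (k + 1) L)
    (ih : ∀ M, IsPathListAssignment n k M →
      (typeCounts n k).1 ≤ colCount (pathGraph (k + 1)) M ∧
        (colCount (pathGraph (k + 1)) M = (typeCounts n k).1 → IsTypeA n k M)) :
    (typeCounts n (k + 1)).2 ≤ colCount (pathGraph (k + 2)) L ∧
      (colCount (pathGraph (k + 2)) L = (typeCounts n (k + 1)).2 →
        ∃ c ∈ L 0, c ∈ L 1 ∧ (L 1).erase c = L (Fin.last (k + 1)) ∧
          ∃ T, ∀ i : Fin (k + 2), 2 ≤ i.val → i.val ≤ k → L i = T) := by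
  have hle := h.le_colCount_eraseHead_tail hn hk fun M hM => (ih M hM).1
  have hA : ∀ c, colCount (pathGraph (k + 1)) (eraseHead c (Fin.tail L)) = (typeCounts n k).1 →
      c ∈ L 1 ∧ (L 1).erase c = L (Fin.last (k + 1)) ∧
        ∃ T, ∀ i : Fin (k + 2), 2 ≤ i.val → i.val ≤ k → L i = T := by
    intro c hc
    have hc1 := (hle c).2 hc
    obtain ⟨S, T, -, -, -, hz, hl, hi⟩ := (ih _ (h.eraseHead_tail hk hc1)).2 hc
    rw [eraseHead_zero, Fin.tail, Fin.succ_zero_eq_one] at hz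
    rw [eraseHead_tail_last hk] at hl
    refine ⟨hc1, hz.trans hl.symm, T, fun i h2 hik => ?_⟩
    have hj0 : (⟨i - 1, by omega⟩ : Fin (k + 1)) ≠ 0 := by
      simp only [Ne, Fin.ext_iff, Fin.val_zero]; omega
    have := hi ⟨i - 1, by omega⟩ hj0 (by simp only [Ne, Fin.ext_iff, Fin.val_last]; omega)
    rw [eraseHead_of_ne _ _ hj0, Fin.tail] at this
    rwa [show Fin.succ (⟨i - 1, by omega⟩ : Fin (k + 1)) = i from
      Fin.ext (by simp only [Fin.val_succ]; omega)] at this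
  have hcard0 := h.zero
  have hB : (typeCounts n (k + 1)).2 =
      (typeCounts n k).1 + (n - 2) * ((typeCounts n k).1 + 1) := by
    rw [← (typeCounts_parity hn k).2 hodd]; rfl
  rw [colCount_path_succ, hB]
  by_cases hex : ∃ c ∈ L 0,
      colCount (pathGraph (k + 1)) (eraseHead c (Fin.tail L)) = (typeCounts n k).1
  · obtain ⟨c, hc, hcA⟩ := hex
    obtain ⟨hc1, hcl, hT⟩ := hA c hcA
    refine ⟨?_, fun _ => ⟨c, hc, hc1, hcl, hT⟩⟩
    rw [← Finset.add_sum_erase _ _ hc, hcA]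
    have hcard : ((L 0).erase c).card = n - 2 := by
      rw [Finset.card_erase_of_mem hc]; omega
    rw [← hcard, ← smul_eq_mul]
    refine Nat.add_le_add_left (Finset.card_nsmul_le_sum _ _ _ fun c' hc' => ?_) _
    refine Nat.lt_of_le_of_ne (hle c').1 fun he => Finset.ne_of_mem_erase hc' ?_
    obtain ⟨hc1', hcl', -⟩ := hA c' he.symm
    exact Finset.erase_injOn _ hc1' hc1 (hcl'.trans hcl.symm)
  · have hlt : (n - 1) * ((typeCounts n k).1 + 1) ≤
        ∑ c ∈ L 0, colCount (pathGraph (k + 1)) (eraseHead c (Fin.tail L)) := by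
      rw [← hcard0, ← smul_eq_mul]
      exact Finset.card_nsmul_le_sum _ _ _ fun c hc =>
        Nat.lt_of_le_of_ne (hle c).1 fun he => hex ⟨c, hc, he.symm⟩
    rw [show n - 1 = n - 2 + 1 by omega, add_mul, one_mul] at hlt
    exact ⟨by omega, fun _ => by omega⟩

theorem typeB_step {L : Fin (k + 2) → Finset ℕ} (hn : 3 ≤ n) (hk : k ≠ 0) (hodd : Odd k)
    (h : IsPathListAssignment n (k + 1) L)
    (ih : ∀ M, IsPathListAssignment n k M →
      (typeCounts n k).1 ≤ colCount (pathGraph (k + 1)) M ∧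
        (colCount (pathGraph (k + 1)) M = (typeCounts n k).1 → IsTypeA n k M)) :
    (typeCounts n (k + 1)).2 ≤ colCount (pathGraph (k + 2)) L ∧
      (colCount (pathGraph (k + 2)) L = (typeCounts n (k + 1)).2 → IsTypeB n (k + 1) L) := by
  have hfwd := typeB_step_aux hn hk hodd h ih
  refine ⟨hfwd.1, fun heq => ?_⟩
  obtain ⟨c, hc, hc1, hcl, T, hT⟩ := hfwd.2 heq
  obtain ⟨d, -, -, hdl, T', hT'⟩ := (typeB_step_aux hn hk hodd h.comp_rev ih).2
    ((colCount_path_comp_rev L).trans heq)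
  simp only [Function.comp_apply, Fin.rev_last] at hdl hT'
  have hpen : Fin.rev (1 : Fin (k + 2)) = ⟨k, by omega⟩ :=
    Fin.ext (by simp [Fin.val_rev])
  rw [hpen] at hdl
  have hrev : ∀ i : Fin (k + 2), 1 ≤ i.val → i.val < k → L i = T' := fun i h1 h2 => by
    have := hT' i.rev (by rw [Fin.val_rev]; omega) (by rw [Fin.val_rev]; omega)
    rwa [Fin.rev_rev] at this
  have hint : ∀ i : Fin (k + 2), i ≠ 0 → i ≠ Fin.last (k + 1) → L i = L 1 := by
    intro i hi hi'
    have hi0 : i.val ≠ 0 := fun h => hi (Fin.ext h)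
    have hil : i.val ≠ k + 1 := fun h => hi' (Fin.ext h)
    have hlt := i.isLt
    rcases eq_or_ne i.val 1 with h1 | h1
    · rw [show i = 1 from Fin.ext (by simpa using h1)]
    · have hk3 : 3 ≤ k := by
        obtain ⟨r, hr⟩ := hodd
        omega
      have h1' : L 1 = T' := hrev 1 (by simp) (by simp; omega)
      have h2 := hrev ⟨2, by omega⟩ (by simp) (by simp; omega)
      have h2' := hT ⟨2, by omega⟩ (by simp) (by simp; omega)
      rw [h1', ← h2, h2', hT i (by omega) (by omega)]
  have hk1 : L ⟨k, by omega⟩ = L 1 := hint _ (by simpa [Fin.ext_iff] using hk)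
    (by simp [Fin.ext_iff])
  rw [hk1] at hdl
  refine ⟨L 0, L (Fin.last (k + 1)), L 1, h.zero, h.last, h.card_one hk, ?_, ?_, fun he => ?_,
    rfl, rfl, hint⟩
  · rw [← hdl]; exact Finset.erase_subset _ _
  · rw [← hcl]; exact Finset.erase_subset _ _
  · rw [he, ← hcl] at hc
    exact Finset.notMem_erase _ _ hc

theorem typeCounts_le_colCount (hn : 3 ≤ n) (hk : 1 ≤ k) (L : Fin (k + 1) → Finset ℕ)
    (h : IsPathListAssignment n k L) :
    (Odd k → (typeCounts n k).1 ≤ colCount (pathGraph (k + 1)) L ∧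
      (colCount (pathGraph (k + 1)) L = (typeCounts n k).1 → IsTypeA n k L)) ∧
    (Even k → (typeCounts n k).2 ≤ colCount (pathGraph (k + 1)) L ∧
      (colCount (pathGraph (k + 1)) L = (typeCounts n k).2 → IsTypeB n k L)) := by
  induction k, hk using Nat.le_induction with
  | base => exact ⟨fun _ => h.typeCounts_one_le_colCount hn, fun h => by simp at h⟩
  | succ k hk ih =>
    refine ⟨fun hodd => ?_, fun hev => ?_⟩
    · have hev : Even k := by simpa [Nat.odd_add_one] using hodd
      exact h.typeA_step hn (by omega) hev fun M hM => (ih M hM).2 hev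
    · have hodd : Odd k := by simpa [Nat.even_add_one] using hev
      exact h.typeB_step hn (by omega) hodd fun M hM => (ih M hM).1 hodd

theorem endErasedLists {T : Finset ℕ} (hk : k ≠ 0) (hT : T.card = n) {d₁ d₂ : ℕ}
    (h₁ : d₁ ∈ T) (h₂ : d₂ ∈ T) : IsPathListAssignment n k (endErasedLists k T d₁ d₂) where
  zero := by simp [_root_.endErasedLists, Finset.card_erase_of_mem h₁, hT]
  last := by
    have : Fin.last k ≠ 0 := by rw [Ne, Fin.ext_iff]; simpa using hk
    simp [_root_.endErasedLists, this, Finset.card_erase_of_mem h₂, hT]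
  interior i hi hi' := by simp [_root_.endErasedLists, hi, hi', hT]

theorem colCount_le_of_minimizing {L M : Fin (k + 1) → Finset ℕ} (hL : IsPathListAssignment n k L)
    (hM : IsPathListAssignment n k M) (hmin : Minimizing (pathGraph (k + 1)) L) :
    colCount (pathGraph (k + 1)) L ≤ colCount (pathGraph (k + 1)) M := by
  refine hmin M fun i => ?_
  by_cases h0 : i = 0
  · rw [h0, hL.zero, hM.zero]
  by_cases hl : i = Fin.last k
  · rw [hl, hL.last, hM.last]
  rw [hL.interior i h0 hl, hM.interior i h0 hl]

end IsPathListAssignment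

theorem stmt19 (n k : ℕ) (hn : 3 ≤ n) (hk : 2 ≤ k)
    (L : Fin (k + 1) → Finset ℕ)
    (h0 : (L 0).card = n - 1) (hlast : (L (Fin.last k)).card = n - 1)
    (hint : ∀ i : Fin (k + 1), i ≠ 0 → i ≠ Fin.last k → (L i).card = n)
    (hmin : Minimizing (pathGraph (k + 1)) L) :
    (Odd k → IsTypeA n k L) ∧ (Even k → IsTypeB n k L) ∧
    ∀ LA LB : Fin (k + 1) → Finset ℕ, IsTypeA n k LA → IsTypeB n k LB →
      (Odd k → colCount (pathGraph (k + 1)) L = colCount (pathGraph (k + 1)) LA) ∧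
      (Even k →
        (colCount (pathGraph (k + 1)) L : ℤ) =
          colCount (pathGraph (k + 1)) LA - (-1) ^ k) := by
  have hL : IsPathListAssignment n k L := ⟨h0, hlast, hint⟩
  have hk0 : k ≠ 0 := by omega
  have hn0 : n ≠ 0 := by omega
  have hle : ∀ d < n, colCount (pathGraph (k + 1)) L ≤
      if 0 = d then (typeCounts n k).1 else (typeCounts n k).2 := fun d hd => by
    have h0n : 0 ∈ Finset.range n := Finset.mem_range.2 (by omega)
    rw [← colCount_endErasedLists hk0 (Finset.card_range n) h0n (Finset.mem_range.2 hd)]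
    exact hL.colCount_le_of_minimizing
      (.endErasedLists hk0 (Finset.card_range n) h0n (Finset.mem_range.2 hd)) hmin
  have hleA : colCount (pathGraph (k + 1)) L ≤ (typeCounts n k).1 := hle 0 (by omega)
  have hleB : colCount (pathGraph (k + 1)) L ≤ (typeCounts n k).2 := hle 1 (by omega)
  obtain ⟨hodd, heven⟩ := IsPathListAssignment.typeCounts_le_colCount hn (by omega) L hL
  refine ⟨fun h => (hodd h).2 (hleA.antisymm (hodd h).1),
    fun h => (heven h).2 (hleB.antisymm (heven h).1), fun LA LB hLA _ => ⟨fun h => ?_, fun h => ?_⟩⟩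
  · rw [hLA.colCount_eq hn0 hk0, hleA.antisymm (hodd h).1]
  · rw [hLA.colCount_eq hn0 hk0, hleB.antisymm (heven h).1, h.neg_one_pow,
      (typeCounts_parity hn k).1 h]
    push_cast
    ring
end
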